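/- For every α ∈ (0,1), log H_{1,∞}(α) = ∫_ℝ 𝓟_α(x) · log( 𝓟_α(x) / (1−α) ) dx, where 𝓟_α(x) := sin(πα) / (2(cosh(πx) − cos(πα))). -/

import Mathlib

open MeasureTheory Complex Filter Set
open scoped Real ENNReal Topology

noncomputable section

def Strip : Set ℂ := {z : ℂ | 0 < z.im ∧ z.im < 1}

def bLine (h : ℂ → ℂ) (y : ℝ) : ℝ → ℂ := fun x => h (x + y * Complex.I)

def hardyNorm (p q : ℝ≥0∞) (h : ℂ → ℂ) : ℝ≥0∞ :=
  ⨆ y ∈ Set.Ioo (0:ℝ) 1,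
    ⨅ (f : ℝ → ℂ) (g : ℝ → ℂ) (_ : Measurable f) (_ : Measurable g)
      (_ : f + g = bLine h y),
      ENNReal.ofReal (1 - y)⁻¹ * eLpNorm f p volume +
        ENNReal.ofReal y⁻¹ * eLpNorm g q volume

def MemHardy (p q : ℝ≥0∞) (h : ℂ → ℂ) : Prop :=
  DifferentiableOn ℂ h Strip ∧ hardyNorm p q h < ⊤

def IsTrace0 (h : ℂ → ℂ) (v : ℝ → ℂ) : Prop :=
  ∀ φ : SchwartzMap ℝ ℂ,
    Tendsto (fun y : ℝ => ∫ x : ℝ, h (x + y * Complex.I) * (starRingEnd ℂ) (φ x))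
      (𝓝[>] (0:ℝ)) (𝓝 (∫ x : ℝ, v x * (starRingEnd ℂ) (φ x)))

def IsTrace1 (h : ℂ → ℂ) (w : ℝ → ℂ) : Prop :=
  ∀ φ : SchwartzMap ℝ ℂ,
    Tendsto (fun y : ℝ => ∫ x : ℝ, h (x + y * Complex.I) * (starRingEnd ℂ) (φ x))
      (𝓝[<] (1:ℝ)) (𝓝 (∫ x : ℝ, w x * (starRingEnd ℂ) (φ x)))

def ratioSet (p q : ℝ≥0∞) (α : ℝ) : Set ℝ :=
  { r | ∃ (h : ℂ → ℂ) (h0 h1 : ℝ → ℂ), MemHardy p q h ∧ (∃ z ∈ Strip, h z ≠ 0) ∧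
      IsTrace0 h h0 ∧ IsTrace1 h h1 ∧ MemLp h0 p volume ∧ MemLp h1 q volume ∧
      r = (eLpNorm (bLine h α) ⊤ volume).toReal /
        ((eLpNorm h0 p volume).toReal ^ (1 - α) * (eLpNorm h1 q volume).toReal ^ α) }

/-- `H_{p,q}(α)`: the optimal value of the generalized three lines problem. -/
def Hval (p q : ℝ≥0∞) (α : ℝ) : ℝ := sSup (ratioSet p q α)

/-- The Poisson kernel of the strip. -/
def Pker (y x : ℝ) : ℝ :=
  Real.sin (Real.pi * y) / (2 * (Real.cosh (Real.pi * x) - Real.cos (Real.pi * y)))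

section helpers
open scoped ContDiff

lemma cosh_ge_aux (s : ℝ) : 1 + s ^ 2 / 2 ≤ Real.cosh s := by
  have h1 : Real.cosh s = 1 + 2 * Real.sinh (s / 2) ^ 2 := by
    have := Real.cosh_two_mul (s / 2)
    rw [mul_div_cancel₀ s two_ne_zero] at this
    rw [this, Real.cosh_sq]; ring
  have h2 : (s / 2) ^ 2 ≤ Real.sinh (s / 2) ^ 2 := by
    rw [← sq_abs, ← sq_abs (Real.sinh (s / 2))]
    have : |s / 2| ≤ |Real.sinh (s / 2)| := by
      rw [Real.abs_sinh]; exact Real.self_le_sinh_iff.2 (abs_nonneg _)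
    gcongr
  rw [h1]; nlinarith

lemma cosh_ge (x : ℝ) : 1 + x ^ 2 ≤ Real.cosh (π * x / 2) := by
  refine le_trans ?_ (cosh_ge_aux _)
  have : (3 : ℝ) < π := Real.pi_gt_three
  have h : (9:ℝ) ≤ π ^ 2 := by nlinarith
  have : (π * x / 2) ^ 2 / 2 = π ^ 2 * x ^ 2 / 8 := by ring
  rw [this]; nlinarith [sq_nonneg x]

lemma norm_sinh_sq (z : ℂ) : ‖Complex.sinh z‖ ^ 2 = Real.sinh z.re ^ 2 + Real.sin z.im ^ 2 := by
  conv_lhs => rw [← Complex.re_add_im z, Complex.sinh_add, Complex.sinh_mul_I, Complex.cosh_mul_I]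
  rw [← Complex.normSq_eq_norm_sq, ← Complex.ofReal_sinh, ← Complex.ofReal_cosh,
    ← Complex.ofReal_sin, ← Complex.ofReal_cos, Complex.normSq_apply]
  simp only [add_re, mul_re, add_im, mul_im, ofReal_re, ofReal_im, I_re, I_im, mul_zero, zero_mul,
    mul_one, sub_zero, add_zero, zero_add, sub_self]
  linear_combination (Real.sin z.im) ^ 2 * Real.cosh_sq z.re +
    Real.sinh z.re ^ 2 * Real.sin_sq_add_cos_sq z.im

lemma abs_sinh_le_norm (z : ℂ) : |Real.sinh z.re| ≤ ‖Complex.sinh z‖ := by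
  apply abs_le_of_sq_le_sq _ (norm_nonneg _)
  rw [norm_sinh_sq]; nlinarith [sq_nonneg (Real.sin z.im)]

lemma sin_cosh_le_norm (z : ℂ) : |Real.sin z.im| * Real.cosh z.re ≤ ‖Complex.sinh z‖ := by
  apply le_of_sq_le_sq _ (norm_nonneg _)
  rw [norm_sinh_sq, mul_pow, sq_abs, Real.cosh_sq]
  nlinarith [Real.sin_sq_le_one z.im, sq_nonneg (Real.sinh z.re)]

/-- weight -/
def W (x : ℝ) : ℝ := (1 + x ^ 2)⁻¹

lemma W_pos (x : ℝ) : 0 < W x := by unfold W; positivity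
lemma W_le_one (x : ℝ) : W x ≤ 1 := by
  unfold W; exact inv_le_one_of_one_le₀ (by nlinarith [sq_nonneg x])
lemma W_cont : Continuous W := by
  unfold W
  exact (by fun_prop : Continuous fun x : ℝ => 1 + x ^ 2).inv₀ (fun x => by positivity)
lemma W_int : Integrable W := integrable_inv_one_add_sq
lemma W_neg (x : ℝ) : W (-x) = W x := by simp [W]
lemma W_shift (x t : ℝ) : W (x - t) ≤ 2 * (1 + x ^ 2) * W t := by
  unfold W
  rw [inv_eq_one_div, ← div_eq_mul_inv, div_le_div_iff₀ (by positivity) (by positivity)]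
  nlinarith [sq_nonneg (x * (x - t)), sq_nonneg (x - (t - x)), sq_nonneg t]
lemma W_shift_int (x : ℝ) : Integrable (fun t => W (x - t)) := W_int.comp_sub_left x
lemma inv_cosh_le (x : ℝ) : (Real.cosh (π * x / 2))⁻¹ ≤ W x := by
  unfold W; exact inv_anti₀ (by positivity) (cosh_ge x)

lemma den_eq (y x : ℝ) : Real.cosh (π * x) - Real.cos (π * y)
    = 2 * (Real.sinh (π * x / 2) ^ 2 + Real.sin (π * y / 2) ^ 2) := by
  have h1 := Real.cosh_two_mul (π * x / 2)
  have h2 := Real.cos_two_mul (π * y / 2)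
  rw [mul_div_cancel₀ _ two_ne_zero] at h1 h2
  rw [h1, h2, Real.cosh_sq]
  nlinarith [Real.sin_sq_add_cos_sq (π * y / 2)]

lemma Pker_eq (y x : ℝ) : Pker y x = Real.sin (π * y / 2) * Real.cos (π * y / 2) /
    (2 * (Real.sinh (π * x / 2) ^ 2 + Real.sin (π * y / 2) ^ 2)) := by
  have h2 := Real.sin_two_mul (π * y / 2)
  rw [mul_div_cancel₀ _ two_ne_zero] at h2
  rw [Pker, den_eq, h2, mul_assoc, mul_div_mul_left _ _ two_ne_zero]

lemma sin_half_pos {y : ℝ} (hy : y ∈ Ioo (0:ℝ) 2) : 0 < Real.sin (π * y / 2) := by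
  apply Real.sin_pos_of_pos_of_lt_pi
  · have := hy.1; have := Real.pi_pos; positivity
  · have := hy.2; have := Real.pi_pos; nlinarith

lemma Pker_nonneg {y : ℝ} (hy : y ∈ Icc (0:ℝ) 1) (x : ℝ) : 0 ≤ Pker y x := by
  unfold Pker
  apply div_nonneg
  · apply Real.sin_nonneg_of_nonneg_of_le_pi
    · have := hy.1; have := Real.pi_pos; positivity
    · have := hy.2; have := Real.pi_pos; nlinarith
  · rw [den_eq]; positivity

lemma Pker_neg (y x : ℝ) : Pker y (-x) = Pker y x := by simp [Pker]

lemma Pker_two_sub (y x : ℝ) : Pker (2 - y) x = - Pker y x := by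
  unfold Pker
  rw [mul_sub, mul_comm π 2, Real.sin_two_pi_sub, Real.cos_two_pi_sub, neg_div]

lemma abs_Pker {y : ℝ} (hy : y ∈ Ioo (0:ℝ) 2) (x : ℝ) :
    |Pker y x| ≤ Pker (min y (2 - y)) x := by
  rcases le_total y 1 with h | h
  · rw [min_eq_left (by linarith), abs_of_nonneg (Pker_nonneg ⟨hy.1.le, h⟩ x)]
  · have h2 := Pker_two_sub y x
    rw [min_eq_right (by linarith)]
    rw [← abs_neg, ← h2, abs_of_nonneg (Pker_nonneg ⟨by linarith [hy.2], by linarith⟩ x)]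

lemma Pker_cont {y : ℝ} (hy : y ∈ Ioo (0:ℝ) 2) : Continuous (Pker y) := by
  unfold Pker
  apply Continuous.div (by fun_prop) (by fun_prop)
  intro x
  rw [den_eq]
  have := sin_half_pos hy
  positivity

lemma Pker_le_W {y : ℝ} (hy : y ∈ Ioo (0:ℝ) 2) (x : ℝ) :
    |Pker y x| ≤ (Real.sin (π * y / 2))⁻¹ * W x := by
  have hs := sin_half_pos hy
  rw [Pker_eq, abs_div, abs_mul, abs_of_pos hs]
  have hc : |Real.cos (π * y / 2)| ≤ 1 := Real.abs_cos_le_one _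
  have hsle : Real.sin (π * y / 2) ≤ 1 := Real.sin_le_one _
  rw [abs_of_pos (by positivity :
    0 < 2 * (Real.sinh (π * x / 2) ^ 2 + Real.sin (π * y / 2) ^ 2)), W, ← mul_inv, ← one_div, div_le_div_iff₀ (by positivity) (by positivity)]
  have hx : x ^ 2 ≤ Real.sinh (π * x / 2) ^ 2 := by
    have h1 := cosh_ge x
    have h2 := Real.cosh_sq (π * x / 2)
    nlinarith [sq_nonneg x]
  set s := Real.sin (π * y / 2)
  have : s * |Real.cos (π * y / 2)| * (s * (1 + x ^ 2)) ≤ s * 1 * (s * (1 + x^2)) := by gcongr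
  have h3 : s ^ 2 * x ^ 2 ≤ x ^ 2 := by
    have : s ^ 2 ≤ 1 := by nlinarith
    nlinarith [sq_nonneg x]
  nlinarith [sq_nonneg x]

lemma Pker_int {y : ℝ} (hy : y ∈ Ioo (0:ℝ) 2) : Integrable (Pker y) :=
  (W_int.const_mul _).mono' (Pker_cont hy).aestronglyMeasurable
    (Eventually.of_forall fun x => Pker_le_W hy x)

lemma abs_mul_Pker_le (y x : ℝ) : |x| * |Pker y x| ≤ W x := by
  rcases eq_or_ne x 0 with rfl | hx
  · simp [W]
  have hx' : 0 < |x| := abs_pos.2 hx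
  have hc : |Real.cos (π * y / 2)| ≤ 1 := Real.abs_cos_le_one _
  have hsinh : |x| * (1 + x ^ 2) / 4 ≤ |Real.sinh (π * x / 2)| := by
    rw [Real.abs_sinh]
    have h1 : |π * x / 2| = 2 * (π * |x| / 4) := by
      rw [abs_div, abs_mul, abs_of_pos Real.pi_pos]; norm_num; ring
    rw [h1, Real.sinh_two_mul]
    have h2 : π * |x| / 4 ≤ Real.sinh (π * |x| / 4) :=
      Real.self_le_sinh_iff.2 (by have := Real.pi_pos; positivity)
    have h3 := cosh_ge_aux (π * |x| / 4)
    have hp : (3 : ℝ) < π := Real.pi_gt_three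
    have h : (9:ℝ) ≤ π ^ 2 := by nlinarith
    have h4 : (1 + x ^ 2) / 4 ≤ Real.cosh (π * |x| / 4) := by
      refine le_trans ?_ h3
      have : (π * |x| / 4) ^ 2 / 2 = π ^ 2 * x ^ 2 / 32 := by
        rw [div_pow, mul_pow, sq_abs]; ring
      rw [this]; nlinarith [sq_nonneg x]
    have h5 : |x| / 2 ≤ Real.sinh (π * |x| / 4) := by nlinarith
    have : |x| / 2 * ((1 + x ^ 2) / 4) ≤ Real.sinh (π * |x| / 4) * Real.cosh (π * |x| / 4) := by
      gcongr
    nlinarith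
  have hpos : 0 < |Real.sinh (π * x / 2)| := lt_of_lt_of_le (by positivity) hsinh
  rw [Pker_eq, abs_div, abs_mul, W]
  set S := |Real.sinh (π * x / 2)| with hS
  set s := |Real.sin (π * y / 2)| with hs
  have e : |2 * (Real.sinh (π * x / 2) ^ 2 + Real.sin (π * y / 2) ^ 2)| = 2 * (S ^ 2 + s ^ 2) := by
    rw [abs_of_nonneg (by positivity), hS, hs, sq_abs, sq_abs]
  rw [e]
  have h0 : 0 ≤ s := abs_nonneg _
  rw [← mul_div_assoc, div_le_iff₀ (by positivity), inv_mul_eq_div, le_div_iff₀ (by positivity)]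
  have h6 : s * |Real.cos (π * y / 2)| ≤ s := by nlinarith
  calc |x| * (s * |Real.cos (π * y / 2)|) * (1 + x ^ 2) ≤ |x| * s * (1 + x ^ 2) := by gcongr
    _ = 4 * (|x| * (1 + x ^ 2) / 4) * s := by ring
    _ ≤ 4 * S * s := by gcongr
    _ ≤ _ := by nlinarith [sq_nonneg (S - s)]

lemma Pker_integral {y : ℝ} (hy : y ∈ Ioo (0:ℝ) 2) : ∫ x, Pker y x = 1 - y := by
  have hs := sin_half_pos hy
  have hpi := Real.pi_pos
  set b := π * y / 2 with hb
  have hder : ∀ x, HasDerivAt (fun x : ℝ => π⁻¹ * Real.arctan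
      (Real.sinh (π * x / 2) / Real.cosh (π * x / 2) * (Real.cos b / Real.sin b))) (Pker y x) x := by
    intro x
    have hl : HasDerivAt (fun x : ℝ => π * x / 2) (π / 2) x := by
      simpa using ((hasDerivAt_id x).const_mul π).div_const 2
    have hC := Real.cosh_pos (π * x / 2)
    have h1 := (((hl.sinh.div hl.cosh hC.ne').mul_const (Real.cos b / Real.sin b)).arctan).const_mul π⁻¹
    refine h1.congr_deriv ?_
    symm
    rw [Pker_eq, ← hb]
    have e1 := Real.cosh_sq (π * x / 2)
    have e2 := Real.sin_sq_add_cos_sq b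
    set C := Real.cosh (π * x / 2)
    set S := Real.sinh (π * x / 2)
    set s := Real.sin b
    set c := Real.cos b
    have hne : C ^ 2 * s ^ 2 + S ^ 2 * c ^ 2 = S ^ 2 + s ^ 2 := by
      rw [e1]; linear_combination S ^ 2 * e2
    have hp : 0 < S ^ 2 + s ^ 2 := by positivity
    have : 1 + (S / C * (c / s)) ^ 2 = (S ^ 2 + s ^ 2) / (C ^ 2 * s ^ 2) := by
      rw [← hne]; field_simp
    simp only [Pi.div_apply]
    rw [this]
    field_simp
    linear_combination (-c) * e1
  have key : ∀ r : ℝ, Real.arctan (r * (Real.cos b / Real.sin b)) =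
      Real.arctan (r * (Real.cos b / Real.sin b)) := fun _ => rfl
  have hcot : Real.arctan (Real.cos b / Real.sin b) = π / 2 - b := by
    apply Real.arctan_eq_of_tan_eq
    · rw [Real.tan_eq_sin_div_cos, Real.sin_pi_div_two_sub, Real.cos_pi_div_two_sub]
    · constructor <;> [skip; skip] <;> rw [hb] <;> nlinarith [hy.1, hy.2]
  have htop : Tendsto (fun x : ℝ => Real.sinh (π * x / 2) / Real.cosh (π * x / 2)) atTop (𝓝 1) := by
    have : (fun x : ℝ => Real.sinh (π * x / 2) / Real.cosh (π * x / 2)) =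
        fun x => (1 - Real.exp (-(π * x))) / (1 + Real.exp (-(π * x))) := by
      ext x
      rw [Real.sinh_eq, Real.cosh_eq]
      have e : Real.exp (-(π * x)) = Real.exp (-(π * x / 2)) / Real.exp (π * x / 2) := by
        rw [← Real.exp_sub]; ring_nf
      rw [e]
      field_simp
    rw [this]
    have h0 : Tendsto (fun x : ℝ => Real.exp (-(π * x))) atTop (𝓝 0) := by
      apply Real.tendsto_exp_neg_atTop_nhds_zero.comp
      exact tendsto_id.const_mul_atTop hpi
    have := (h0.const_sub 1).div (h0.const_add 1) (by norm_num)
    rw [sub_zero, add_zero, div_one] at this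
    exact this
  have hbot : Tendsto (fun x : ℝ => Real.sinh (π * x / 2) / Real.cosh (π * x / 2)) atBot (𝓝 (-1)) := by
    have := (htop.comp tendsto_neg_atBot_atTop).neg
    refine this.congr fun x => ?_
    simp only [Function.comp]
    rw [mul_neg, neg_div, Real.sinh_neg, Real.cosh_neg]; ring
  have T := integral_of_hasDerivAt_of_tendsto hder (Pker_int hy)
    (((Real.continuous_arctan.tendsto _).comp (hbot.mul_const _)).const_mul _)
    (((Real.continuous_arctan.tendsto _).comp (htop.mul_const _)).const_mul _)
  rw [T, one_mul, neg_one_mul, Real.arctan_neg, hcot, hb]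
  field_simp
  ring

/-- doubled strip -/
def Str2 : Set ℂ := {z : ℂ | 0 < z.im ∧ z.im < 2}

lemma Str2_open : IsOpen Str2 :=
  (isOpen_lt continuous_const continuous_im).inter (isOpen_lt continuous_im continuous_const)

/-- Schwarz kernel -/
def Qk (z : ℂ) (t : ℝ) : ℂ :=
  (I / 2) * (Complex.cosh (π * z / 2) / (Complex.sinh (π * (z - t) / 2) * Complex.cosh (π * t / 2)))

lemma arg_re (z : ℂ) (t : ℝ) : ((π:ℂ) * (z - t) / 2).re = π * (z.re - t) / 2 := by
  have : ((π:ℂ) * (z - t) / 2) = ((π / 2 : ℝ) : ℂ) * (z - t) := by push_cast; ring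
  rw [this, re_ofReal_mul]; simp; ring

lemma arg_im (z : ℂ) (t : ℝ) : ((π:ℂ) * (z - t) / 2).im = π * z.im / 2 := by
  have : ((π:ℂ) * (z - t) / 2) = ((π / 2 : ℝ) : ℂ) * (z - t) := by push_cast; ring
  rw [this, im_ofReal_mul]; simp; ring

lemma sinh_lb {z : ℂ} (hz : z ∈ Str2) (t : ℝ) :
    Real.sin (π * z.im / 2) * (1 + (z.re - t) ^ 2) ≤ ‖Complex.sinh (π * (z - t) / 2)‖ := by
  have h := sin_cosh_le_norm (π * (z - t) / 2)
  rw [arg_re, arg_im, abs_of_pos (sin_half_pos hz)] at h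
  have hs := sin_half_pos hz
  have := cosh_ge (z.re - t)
  refine le_trans ?_ h
  gcongr

lemma sinh_ne {z : ℂ} (hz : z ∈ Str2) (t : ℝ) : Complex.sinh (π * (z - t) / 2) ≠ 0 := by
  have hs := sin_half_pos hz
  rw [← norm_pos_iff]
  exact lt_of_lt_of_le (by positivity) (sinh_lb hz t)

lemma ccosh_eq (t : ℝ) : Complex.cosh (π * t / 2) = ((Real.cosh (π * t / 2) : ℝ) : ℂ) := by
  push_cast; rfl

lemma ccosh_ne (t : ℝ) : Complex.cosh ((π:ℂ) * t / 2) ≠ 0 := by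
  rw [ccosh_eq]; exact_mod_cast (Real.cosh_pos _).ne'

lemma Qk_eq {z : ℂ} (hz : z ∈ Str2) (t : ℝ) :
    Qk z t = (I / 2) * (Complex.cosh (π * (z - t) / 2) / Complex.sinh (π * (z - t) / 2)
      + Complex.sinh (π * t / 2) / Complex.cosh (π * t / 2)) := by
  have h1 := sinh_ne hz t
  have h2 := ccosh_ne t
  unfold Qk
  have : Complex.cosh (π * z / 2) = Complex.cosh (π * (z - t) / 2 + π * t / 2) := by
    congr 1; ring
  rw [this, Complex.cosh_add]
  field_simp

lemma Qk_re {z : ℂ} (hz : z ∈ Str2) (t : ℝ) : (Qk z t).re = Pker z.im (z.re - t) := by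
  rw [Qk_eq hz, Pker_eq]
  have e1 : Complex.sinh (π * t / 2) / Complex.cosh (π * t / 2) =
      ((Real.sinh (π * t / 2) / Real.cosh (π * t / 2) : ℝ) : ℂ) := by push_cast; rfl
  rw [e1]
  have hn := norm_sinh_sq (π * (z - t) / 2)
  rw [← Complex.normSq_eq_norm_sq] at hn
  set a : ℂ := π * (z - t) / 2 with ha
  have har : a.re = π * (z.re - t) / 2 := arg_re z t
  have hai : a.im = π * z.im / 2 := arg_im z t
  rw [har, hai] at hn
  rw [mul_add, add_re]
  have : (I / 2 * ((Real.sinh (π * t / 2) / Real.cosh (π * t / 2) : ℝ) : ℂ)).re = 0 := by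
    rw [mul_comm, re_ofReal_mul]; simp
  rw [this, add_zero]
  have h2 : (I / 2 * (Complex.cosh a / Complex.sinh a)).re =
     - (Complex.cosh a / Complex.sinh a).im / 2 := by
    have : I / 2 * (Complex.cosh a / Complex.sinh a) = ((1/2 : ℝ):ℂ) * (I * (Complex.cosh a / Complex.sinh a)) := by
      push_cast; ring
    rw [this, re_ofReal_mul, I_mul_re]; ring
  rw [h2, Complex.div_im, hn]
  have s1 : Complex.sinh a = (Real.sinh a.re * Real.cos a.im : ℝ) + (Real.cosh a.re * Real.sin a.im : ℝ) * I := by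
    conv_lhs => rw [← Complex.re_add_im a, Complex.sinh_add, Complex.sinh_mul_I, Complex.cosh_mul_I]
    push_cast; ring
  have s2 : Complex.cosh a = (Real.cosh a.re * Real.cos a.im : ℝ) + (Real.sinh a.re * Real.sin a.im : ℝ) * I := by
    conv_lhs => rw [← Complex.re_add_im a, Complex.cosh_add, Complex.sinh_mul_I, Complex.cosh_mul_I]
    push_cast; ring
  have r1 : (Complex.sinh a).re = Real.sinh a.re * Real.cos a.im := by rw [s1]; simp [-ofReal_mul]
  have r2 : (Complex.sinh a).im = Real.cosh a.re * Real.sin a.im := by rw [s1]; simp [-ofReal_mul]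
  have r3 : (Complex.cosh a).re = Real.cosh a.re * Real.cos a.im := by rw [s2]; simp [-ofReal_mul]
  have r4 : (Complex.cosh a).im = Real.sinh a.re * Real.sin a.im := by rw [s2]; simp [-ofReal_mul]
  rw [r1, r2, r3, r4, har, hai]
  have hs := sin_half_pos hz
  have e := Real.cosh_sq (π * (z.re - t) / 2)
  field_simp
  linear_combination (Real.cos (π * z.im / 2)) * e

section
variable {u : ℝ → ℝ} {M : ℝ}

lemma u_cont (hu : ∀ s t, |u s - u t| ≤ M * |s - t|) : Continuous u := by
  have hM : 0 ≤ M := by have := (abs_nonneg _).trans (hu 1 0); simpa using this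
  refine (LipschitzWith.of_dist_le_mul (K := ⟨M, hM⟩) fun s t => ?_).continuous
  rw [Real.dist_eq, Real.dist_eq]; exact hu s t

lemma u_bd (hu : ∀ s t, |u s - u t| ≤ M * |s - t|) (t : ℝ) : |u t| ≤ (|u 0| + M) * (1 + |t|) := by
  have hM : 0 ≤ M := by have := (abs_nonneg _).trans (hu 1 0); simpa using this
  have h1 := hu t 0
  have h2 : |u t| ≤ |u t - u 0| + |u 0| := by simpa using abs_add_le (u t - u 0) (u 0)
  rw [sub_zero] at h1
  nlinarith [abs_nonneg t, abs_nonneg (u 0)]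

lemma u_bd2 (hu : ∀ s t, |u s - u t| ≤ M * |s - t|) (t : ℝ) : |u t| ≤ 2 * (|u 0| + M) * (1 + t ^ 2) := by
  have hM : 0 ≤ M := by have := (abs_nonneg _).trans (hu 1 0); simpa using this
  refine (u_bd hu t).trans ?_
  have : 1 + |t| ≤ 2 * (1 + t ^ 2) := by nlinarith [sq_abs t, sq_nonneg (|t| - 1), abs_nonneg t]
  have h0 : 0 ≤ |u 0| + M := by positivity
  nlinarith

lemma Qk_cont {z : ℂ} (hz : z ∈ Str2) : Continuous (Qk z) := by
  unfold Qk
  refine continuous_const.mul (Continuous.div continuous_const (by fun_prop) fun t => ?_)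
  exact mul_ne_zero (sinh_ne hz t) (ccosh_ne t)

lemma Qk_int (hu : ∀ s t, |u s - u t| ≤ M * |s - t|) {z : ℂ} (hz : z ∈ Str2) :
    Integrable (fun t => Qk z t * u t) := by
  have hM : 0 ≤ M := by have := (abs_nonneg _).trans (hu 1 0); simpa using this
  have hs := sin_half_pos hz
  have hB := (W_shift_int z.re).const_mul
    (‖Complex.cosh (π * z / 2)‖ * (Real.sin (π * z.im / 2))⁻¹ * (2 * (|u 0| + M)))
  refine hB.mono' ?_ ?_
  · exact ((Qk_cont hz).mul (continuous_ofReal.comp (u_cont hu))).aestronglyMeasurable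
  · refine Eventually.of_forall fun t => ?_
    have h1 := sinh_lb hz t
    have h2 := u_bd2 hu t
    have h3 := cosh_ge t
    rw [Qk, norm_mul, norm_mul, norm_div (Complex.cosh _), norm_mul, ccosh_eq, norm_real, norm_real,
      Real.norm_of_nonneg (Real.cosh_pos _).le, Real.norm_eq_abs]
    have h4 : ‖I / 2‖ ≤ 1 := by simp; norm_num
    calc _ ≤ 1 * (‖Complex.cosh (π * z / 2)‖ / ((Real.sin (π * z.im / 2) * (1 + (z.re - t) ^ 2)) *
          (1 + t ^ 2))) * (2 * (|u 0| + M) * (1 + t ^ 2)) := by gcongr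
      _ = _ := by unfold W; field_simp

lemma Qk_deriv {z : ℂ} (hz : z ∈ Str2) (t : ℝ) :
    HasDerivAt (fun z => Qk z t) (-(I * π / 4) / Complex.sinh (π * (z - t) / 2) ^ 2) z := by
  have hl : HasDerivAt (fun z : ℂ => (π:ℂ) * (z - t) / 2) (π / 2) z := by
    simpa using (((hasDerivAt_id z).sub_const (t:ℂ)).const_mul (π:ℂ)).div_const 2
  have h1 := sinh_ne hz t
  have hd := ((((Complex.hasDerivAt_cosh _).comp z hl).div ((Complex.hasDerivAt_sinh _).comp z hl) h1).add_const
    (Complex.sinh (π * t / 2) / Complex.cosh (π * t / 2))).const_mul (I / 2)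
  have hd2 := hd.congr_of_eventuallyEq (f₁ := fun z => Qk z t) (by
    filter_upwards [Str2_open.mem_nhds hz] with w hw
    rw [Qk_eq hw]; rfl)
  refine hd2.congr_deriv ?_
  have e := Complex.cosh_sq ((π:ℂ) * (z - t) / 2)
  simp only [Function.comp]
  rw [← mul_div_assoc]
  congr 1
  linear_combination (-(I * π / 4)) * e

lemma L_diff (hu : ∀ s t, |u s - u t| ≤ M * |s - t|) :
    DifferentiableOn ℂ (fun z => ∫ t, Qk z t * u t) Str2 := by
  have hM : 0 ≤ M := by have := (abs_nonneg _).trans (hu 1 0); simpa using this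
  intro z₀ hz₀
  -- a compact neighbourhood
  obtain ⟨r, hr, hball⟩ := Metric.isOpen_iff.1 Str2_open z₀ hz₀
  have hK : IsCompact (Metric.closedBall z₀ (r / 2)) := isCompact_closedBall _ _
  have hsub : Metric.closedBall z₀ (r / 2) ⊆ Str2 :=
    (Metric.closedBall_subset_ball (by linarith)).trans hball
  obtain ⟨K, hKb⟩ := hK.exists_bound_of_continuousOn
    (f := fun z : ℂ => (Real.sin (π * z.im / 2))⁻¹ ^ 2) (by
      refine ContinuousOn.pow (ContinuousOn.inv₀ (by fun_prop) fun z hz => ?_) _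
      exact (sin_half_pos (hsub hz)).ne')
  obtain ⟨R, hRb⟩ := hK.exists_bound_of_continuousOn
    (f := fun z : ℂ => z.re) (by fun_prop)
  have hK0 : 0 ≤ K := (norm_nonneg _).trans (hKb z₀ (Metric.mem_closedBall_self (by linarith)))
  have hmain := hasDerivAt_integral_of_dominated_loc_of_deriv_le (𝕜 := ℂ) (μ := volume)
    (F := fun z t => Qk z t * u t) (x₀ := z₀) (s := Metric.closedBall z₀ (r / 2))
    (F' := fun z t => (-(I * π / 4) / Complex.sinh (π * (z - t) / 2) ^ 2) * u t)
    (bound := fun t => (K * (2 * (|u 0| + M)) * (2 * (1 + R ^ 2)) * (2 * (1 + R ^ 2))) * W t)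
    (Metric.closedBall_mem_nhds _ (by linarith)) ?_ (Qk_int hu hz₀) ?_ ?_ (W_int.const_mul _) ?_
  · exact hmain.2.differentiableAt.differentiableWithinAt
  · filter_upwards [Str2_open.mem_nhds hz₀] with z hz
    exact (Qk_int hu hz).aestronglyMeasurable
  · refine Continuous.aestronglyMeasurable ?_
    refine (Continuous.div continuous_const (by fun_prop) fun t => ?_).mul
      (continuous_ofReal.comp (u_cont hu))
    exact pow_ne_zero _ (sinh_ne hz₀ t)
  · refine Eventually.of_forall fun t z hz => ?_
    have hzs := hsub hz
    have h1 := sinh_lb hzs t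
    have h2 := u_bd2 hu t
    have hs := sin_half_pos hzs
    have h3 := hKb z hz
    rw [Real.norm_of_nonneg (by positivity)] at h3
    have hre := hRb z hz
    have hre2 : z.re ^ 2 ≤ R ^ 2 := by
      rw [← sq_abs]; rw [Real.norm_eq_abs] at hre; gcongr
    have h4 := W_shift z.re t
    have h5 : 1 + t ^ 2 ≤ 2 * (1 + R ^ 2) * (1 + (z.re - t) ^ 2) := by
      nlinarith [sq_nonneg (z.re * (z.re - t)), sq_nonneg (z.re + (z.re - t)), sq_nonneg t,
        sq_nonneg (z.re - t), sq_nonneg (z.re + (z.re - t)), sq_nonneg R,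
        mul_nonneg (sq_nonneg R) (sq_nonneg (z.re - t)), sq_nonneg (z.re - (z.re - t)), sq_nonneg (z.re - (t - z.re))]
    have h6 : ‖-(I * (π:ℂ) / 4)‖ ≤ 1 := by
      rw [norm_neg, norm_div, norm_mul, norm_I, norm_real, Real.norm_of_nonneg Real.pi_pos.le]
      have := Real.pi_lt_four
      norm_num; linarith
    rw [norm_mul, norm_div, norm_pow, norm_real, Real.norm_eq_abs]
    calc _ ≤ 1 / (Real.sin (π * z.im / 2) * (1 + (z.re - t) ^ 2)) ^ 2 *
          (2 * (|u 0| + M) * (1 + t ^ 2)) := by gcongr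
      _ = ((Real.sin (π * z.im / 2))⁻¹ ^ 2) * (2 * (|u 0| + M)) *
          ((1 + t ^ 2) * W (z.re - t)) * W (z.re - t) := by unfold W; field_simp
      _ ≤ K * (2 * (|u 0| + M)) * (2 * (1 + R ^ 2)) * (2 * (1 + R ^ 2) * W t) := by
        have := W_pos (z.re - t)
        have := W_pos t
        have h7 : (1 + t ^ 2) * W (z.re - t) ≤ 2 * (1 + R ^ 2) := by
          unfold W; rw [← div_eq_mul_inv, div_le_iff₀ (by positivity)]; exact h5
        have h8 : W (z.re - t) ≤ 2 * (1 + R ^ 2) * W t := by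
          refine h4.trans ?_; gcongr
        gcongr
      _ = _ := by ring
  · refine Eventually.of_forall fun t z hz => ?_
    exact (Qk_deriv (hsub hz) t).mul_const _

lemma L_re (hu : ∀ s t, |u s - u t| ≤ M * |s - t|) {z : ℂ} (hz : z ∈ Str2) :
    (∫ t, Qk z t * u t).re = ∫ t, Pker z.im (z.re - t) * u t := by
  have := integral_re (Qk_int hu hz)
  simp only [RCLike.re_to_complex] at this
  rw [← this]
  congr 1; ext t
  rw [re_mul_ofReal, Qk_re hz]

lemma PU_int (hu : ∀ s t, |u s - u t| ≤ M * |s - t|) {y : ℝ} (hy : y ∈ Ioo (0:ℝ) 2) (x : ℝ) :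
    Integrable (fun t => Pker y (x - t) * u t) := by
  have hz : ((x:ℂ) + y * I) ∈ Str2 := by simpa [Str2] using hy
  have := (Qk_int hu hz).re
  refine this.congr (Eventually.of_forall fun t => ?_)
  simp only [RCLike.re_to_complex]
  rw [re_mul_ofReal, Qk_re hz]; simp

/-- first absolute moment -/
def mom (y : ℝ) : ℝ := ∫ t, |t| * |Pker y t|

lemma mom_int {y : ℝ} (hy : y ∈ Ioo (0:ℝ) 2) : Integrable (fun t => |t| * |Pker y t|) :=
  W_int.mono' ((continuous_abs.mul (Pker_cont hy).abs).aestronglyMeasurable)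
    (Eventually.of_forall fun t => by
      rw [Real.norm_of_nonneg (by positivity)]; exact abs_mul_Pker_le y t)

lemma mom_le {y : ℝ} (hy : y ∈ Ioo (0:ℝ) 2) : mom y ≤ ∫ t, W t :=
  integral_mono (mom_int hy) W_int fun t => abs_mul_Pker_le y t

lemma poisson_est (hu : ∀ s t, |u s - u t| ≤ M * |s - t|) {y : ℝ} (hy : y ∈ Ioo (0:ℝ) 2) (x : ℝ) :
    |(∫ t, Pker y (x - t) * u t) - (1 - y) * u x| ≤ M * mom y := by
  have e1 : (1 - y) * u x = ∫ t, Pker y (x - t) * u x := by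
    rw [integral_mul_const, integral_sub_left_eq_self (fun t => Pker y t), Pker_integral hy]
  have hi : Integrable fun t => Pker y (x - t) * u x :=
    ((Pker_int hy).comp_sub_left x).mul_const _
  rw [e1, ← integral_sub (PU_int hu hy x) hi, mom, ← integral_const_mul,
    ← integral_sub_left_eq_self (fun t => M * (|t| * |Pker y t|)) volume x]
  rw [← Real.norm_eq_abs]
  refine norm_integral_le_of_norm_le (((mom_int hy).const_mul M).comp_sub_left x) ?_
  refine Eventually.of_forall fun t => ?_
  rw [← mul_sub, norm_mul, Real.norm_eq_abs, Real.norm_eq_abs]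
  have := hu t x
  rw [abs_sub_comm t x] at this
  calc _ ≤ |Pker y (x - t)| * (M * |x - t|) := by gcongr
    _ = _ := by ring

lemma mom_tendsto {b : ℝ} (hb : Real.sin (π * b) = 0) {l : Filter ℝ} [l.IsCountablyGenerated]
    (hl : Tendsto id l (𝓝 b)) (hm : ∀ᶠ y in l, y ∈ Ioo (0:ℝ) 2) : Tendsto mom l (𝓝 0) := by
  have h0 : (0:ℝ) = ∫ _ : ℝ, (0:ℝ) := by simp
  rw [h0]
  unfold mom
  refine tendsto_integral_filter_of_dominated_convergence W ?_ ?_ W_int ?_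
  · filter_upwards [hm] with y hy using (mom_int hy).aestronglyMeasurable
  · filter_upwards [hm] with y hy
    refine Eventually.of_forall fun t => ?_
    rw [Real.norm_of_nonneg (by positivity)]; exact abs_mul_Pker_le y t
  · have : ∀ᵐ t : ℝ, t ≠ 0 := by simp [ae_iff]
    filter_upwards [this] with t ht
    have hden : 2 * (Real.cosh (π * t) - Real.cos (π * b)) ≠ 0 := by
      have h1 : 1 < Real.cosh (π * t) := Real.one_lt_cosh.2 (by have := Real.pi_pos; positivity)
      have := Real.cos_le_one (π * b)
      nlinarith
    have hc : ContinuousAt (fun y => |t| * |Pker y t|) b := by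
      unfold Pker
      refine continuousAt_const.mul (ContinuousAt.abs (ContinuousAt.div ?_ ?_ hden)) <;> fun_prop
    have := hc.tendsto.comp hl
    have h00 : |t| * |Pker b t| = 0 := by simp [Pker, hb]
    rw [h00] at this
    exact this

lemma exists_L (hu : ∀ s t, |u s - u t| ≤ M * |s - t|) {α : ℝ} (hα : α ∈ Ioo (0:ℝ) 1) {τ : ℝ} (hτ : 0 < τ) :
    ∃ ε > 0, ∃ L : ℂ → ℂ, ∃ C : ℝ, DifferentiableOn ℂ L {z : ℂ | -ε < z.im ∧ z.im < 1 + ε} ∧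
      (∀ x : ℝ, |(L x).re - u x| ≤ τ * (1 + |x|)) ∧
      (∀ x : ℝ, |(L (x + I)).re| ≤ τ * (1 + |x|)) ∧
      |(L (α * I)).re - ∫ t, Pker α t * u t| ≤ τ ∧
      (∀ z : ℂ, 0 ≤ z.im → z.im ≤ 1 → |(L z).re| ≤ C * (1 + |z.re|)) := by
  have hM : 0 ≤ M := by have := (abs_nonneg _).trans (hu 1 0); simpa using this
  set G : ℂ → ℂ := fun z => ∫ t, Qk z t * u t with hG
  have hid : Tendsto (fun x : ℝ => x) (𝓝[>] (0:ℝ)) (𝓝 0) := tendsto_id.mono_left nhdsWithin_le_nhds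
  have E0 : ∀ᶠ ε in 𝓝[>] (0:ℝ), ε ∈ Ioo (0:ℝ) (1/2) := Ioo_mem_nhdsGT (by norm_num)
  have E1 : Tendsto mom (𝓝[>] (0:ℝ)) (𝓝 0) := by
    refine mom_tendsto (b := 0) (by simp) hid ?_
    filter_upwards [E0] with y hy using ⟨hy.1, by linarith [hy.2]⟩
  have E2 : Tendsto (fun ε => mom (1 + ε)) (𝓝[>] (0:ℝ)) (𝓝 0) := by
    have h1 : Tendsto mom (𝓝 1) (𝓝 0) :=
      mom_tendsto (b := 1) (by simp) tendsto_id (Ioo_mem_nhds (by norm_num) (by norm_num))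
    refine h1.comp ?_
    simpa using hid.const_add 1
  have E3 : Tendsto (fun ε : ℝ => (G (α * I + ε * I)).re) (𝓝[>] (0:ℝ)) (𝓝 (G (α * I)).re) := by
    have hm : (α * I : ℂ) ∈ Str2 := by simpa [Str2] using (⟨hα.1, by linarith [hα.2]⟩ : 0 < α ∧ α < 2)
    have hc : ContinuousAt G (α * I) :=
      ((L_diff hu).continuousOn.continuousAt (Str2_open.mem_nhds hm))
    have h2 : Tendsto (fun ε : ℝ => (α * I + ε * I : ℂ)) (𝓝[>] (0:ℝ)) (𝓝 (α * I)) := by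
      have : Continuous (fun ε : ℝ => (α * I + ε * I : ℂ)) := by fun_prop
      have := this.tendsto 0
      simp only [ofReal_zero, zero_mul, add_zero] at this
      exact this.mono_left nhdsWithin_le_nhds
    exact (continuous_re.tendsto _).comp (hc.tendsto.comp h2)
  have hGα : (G (α * I)).re = ∫ t, Pker α t * u t := by
    have hm : (α * I : ℂ) ∈ Str2 := by simpa [Str2] using (⟨hα.1, by linarith [hα.2]⟩ : 0 < α ∧ α < 2)
    rw [hG, L_re hu hm]
    congr 1; ext t
    simp [Pker_neg]
  set C₀ := |u 0| + M with hC₀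
  have hC₀' : 0 ≤ C₀ := by positivity
  have F1 : ∀ᶠ ε in 𝓝[>] (0:ℝ), M * mom ε < τ / 2 := by
    have := E1.const_mul M
    rw [mul_zero] at this
    exact this.eventually_lt_const (by linarith)
  have F2 : ∀ᶠ ε in 𝓝[>] (0:ℝ), M * mom (1 + ε) < τ / 2 := by
    have := E2.const_mul M
    rw [mul_zero] at this
    exact this.eventually_lt_const (by linarith)
  have F3 : ∀ᶠ ε in 𝓝[>] (0:ℝ), ε * C₀ < τ / 2 := by
    have := hid.mul_const C₀
    rw [zero_mul] at this
    exact this.eventually_lt_const (by linarith)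
  have F4 : ∀ᶠ ε : ℝ in 𝓝[>] (0:ℝ), |(G (α * I + ε * I)).re - (G (α * I)).re| < τ := by
    have := Metric.tendsto_nhds.1 E3 τ hτ
    simpa [Real.dist_eq] using this
  obtain ⟨ε, hε, f1, f2, f3, f4⟩ := (E0.and (F1.and (F2.and (F3.and F4)))).exists
  have hmem : ∀ z : ℂ, -ε < z.im → z.im < 1 + ε → z + ε * I ∈ Str2 := by
    intro z h1 h2
    have := hε.2
    constructor <;> simp <;> linarith
  have hre : ∀ z : ℂ, -ε < z.im → z.im < 1 + ε →
      |(G (z + ε * I)).re - (1 - (z.im + ε)) * u z.re| ≤ M * mom (z.im + ε) := by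
    intro z h1 h2
    have hh := hmem z h1 h2
    rw [hG, L_re hu hh]
    have := poisson_est hu hh z.re
    simpa using this
  refine ⟨ε, hε.1, fun z => G (z + ε * I), M * (∫ t, W t) + C₀, ?_, ?_, ?_, ?_, ?_⟩
  · refine (L_diff hu).comp (by fun_prop) ?_
    intro z hz
    exact hmem z hz.1 hz.2
  · intro x
    have h := hre x (by simp [hε.1]) (by simp; linarith [hε.1])
    simp only [ofReal_im, ofReal_re, zero_add] at h
    have h2 := u_bd hu x
    have h3 : ε * |u x| ≤ τ / 2 * (1 + |x|) := by
      calc ε * |u x| ≤ ε * (C₀ * (1 + |x|)) := by have := hε.1; gcongr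
        _ = (ε * C₀) * (1 + |x|) := by ring
        _ ≤ _ := by gcongr
    have h4 : (G (x + ε * I)).re - u x = ((G (x + ε * I)).re - (1 - ε) * u x) + (- (ε * u x)) := by ring
    rw [h4]
    refine (abs_add_le _ _).trans ?_
    rw [abs_neg, abs_mul, abs_of_pos hε.1]
    nlinarith [abs_nonneg x]
  · intro x
    have h := hre (x + I) (by simp; linarith [hε.1]) (by simp [hε.1])
    simp only [add_im, add_re, I_im, I_re, ofReal_im, ofReal_re, zero_add, add_zero] at h
    have h2 := u_bd hu x
    have h3 : ε * |u x| ≤ τ / 2 * (1 + |x|) := by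
      calc ε * |u x| ≤ ε * (C₀ * (1 + |x|)) := by have := hε.1; gcongr
        _ = (ε * C₀) * (1 + |x|) := by ring
        _ ≤ _ := by gcongr
    have h4 : (G (x + I + ε * I)).re = ((G (x + I + ε * I)).re - (1 - (1 + ε)) * u x) + (- (ε * u x)) := by ring
    rw [h4]
    refine (abs_add_le _ _).trans ?_
    rw [abs_neg, abs_mul, abs_of_pos hε.1]
    nlinarith [abs_nonneg x]
  · rw [← hGα]; exact f4.le
  · intro z h0 h1
    have h := hre z (by linarith [hε.1]) (by linarith [hε.1])
    have h2 := u_bd hu z.re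
    have h5 := mom_le (y := z.im + ε) ⟨by linarith [hε.1], by linarith [hε.2]⟩
    have h4 : (G (z + ε * I)).re = ((G (z + ε * I)).re - (1 - (z.im + ε)) * u z.re) +
      (1 - (z.im + ε)) * u z.re := by ring
    rw [h4]
    refine (abs_add_le _ _).trans ?_
    rw [abs_mul]
    have h6 : |1 - (z.im + ε)| ≤ 1 := abs_le.2 ⟨by linarith [hε.1, hε.2], by linarith [hε.1, hε.2]⟩
    have h7 : |1 - (z.im + ε)| * |u z.re| ≤ 1 * (C₀ * (1 + |z.re|)) := by gcongr
    have h8 : M * mom (z.im + ε) ≤ M * ∫ t, W t := by gcongr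
    have h9 : 0 ≤ M * ∫ t, W t := mul_nonneg hM (integral_nonneg fun t => (W_pos t).le)
    nlinarith [abs_nonneg z.re]
end

lemma Pker_pos {y : ℝ} (hy : y ∈ Ioo (0:ℝ) 1) (x : ℝ) : 0 < Pker y x := by
  unfold Pker
  have hpi := Real.pi_pos
  apply div_pos
  · apply Real.sin_pos_of_pos_of_lt_pi
    · have := hy.1; positivity
    · have := hy.2; nlinarith
  · rw [den_eq]
    have := sin_half_pos (y := y) ⟨hy.1, by linarith [hy.2]⟩
    positivity

/-- boundary data -/
def ua (α t : ℝ) : ℝ := Real.log (Pker α t / (1 - α))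

lemma exp_ua {α : ℝ} (hα : α ∈ Ioo (0:ℝ) 1) (t : ℝ) : Real.exp (ua α t) = Pker α t / (1 - α) := by
  unfold ua
  exact Real.exp_log (div_pos (Pker_pos hα t) (by linarith [hα.2]))

lemma ua_lip {α : ℝ} (hα : α ∈ Ioo (0:ℝ) 1) : ∃ M, ∀ s t, |ua α s - ua α t| ≤ M * |s - t| := by
  have hpi := Real.pi_pos
  set c := Real.cos (π * α) with hc
  have hs : 0 < Real.sin (π * α) := by
    apply Real.sin_pos_of_pos_of_lt_pi
    · have := hα.1; positivity
    · have := hα.2; nlinarith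
  have hc1 : |c| < 1 := by
    have := Real.sin_sq_add_cos_sq (π * α)
    rw [← sq_lt_one_iff_abs_lt_one]
    nlinarith
  have hd : ∀ t : ℝ, (1 - |c|) * Real.cosh (π * t) ≤ Real.cosh (π * t) - c := by
    intro t
    have := Real.one_le_cosh (π * t)
    nlinarith [le_abs_self c, abs_nonneg c]
  have hpos : ∀ t : ℝ, 0 < Real.cosh (π * t) - c := fun t =>
    lt_of_lt_of_le (mul_pos (by linarith) (Real.cosh_pos _)) (hd t)
  have hder : ∀ t : ℝ, HasDerivAt (ua α) (-(Real.sinh (π * t) * π / (Real.cosh (π * t) - c))) t := by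
    intro t
    have e : ua α = fun t => Real.log (Real.sin (π * α) / (2 * (1 - α))) - Real.log (Real.cosh (π * t) - c) := by
      ext t
      have h1 := hα.2
      rw [← Real.log_div (by have : 0 < 1 - α := by linarith
                             positivity) (hpos t).ne']
      unfold ua Pker
      rw [div_div, div_div]; congr 2; ring
    rw [e]
    have hl : HasDerivAt (fun t : ℝ => π * t) π t := by
      simpa using (hasDerivAt_id t).const_mul π
    exact ((hl.cosh.sub_const c).log (hpos t).ne').const_sub _
  refine ⟨π / (1 - |c|), fun s t => ?_⟩
  have := convex_univ.norm_image_sub_le_of_norm_hasDerivWithin_le (f := ua α) (C := π / (1 - |c|))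
    (fun t _ => (hder t).hasDerivWithinAt) (fun t _ => ?_) (mem_univ t) (mem_univ s)
  · simpa [Real.norm_eq_abs] using this
  · rw [norm_neg, Real.norm_eq_abs, abs_div, abs_mul, abs_of_pos hpi, abs_of_pos (hpos t)]
    have h1 : |Real.sinh (π * t)| ≤ Real.cosh (π * t) := by
      rw [abs_le]
      constructor
      · have := Real.exp_pos (π * t); rw [← Real.cosh_add_sinh] at this; linarith
      · exact (Real.sinh_lt_cosh _).le
    have h2 := hd t
    have h3 : 0 < 1 - |c| := by linarith
    rw [div_le_div_iff₀ (hpos t) h3]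
    calc _ ≤ Real.cosh (π * t) * π * (1 - |c|) := by gcongr
      _ = π * ((1 - |c|) * Real.cosh (π * t)) := by ring
      _ ≤ _ := by gcongr

lemma gauss_W (C : ℝ) {τ : ℝ} (hτ : 0 < τ) :
    ∃ K, 0 < K ∧ ∀ x : ℝ, Real.exp (C * (1 + |x|) - τ * x ^ 2 + τ) ≤ K * W x := by
  refine ⟨Real.exp (C + τ + C ^ 2 / (2 * τ)) * (1 + 2 / τ), by positivity, fun x => ?_⟩
  have h1 : C * (1 + |x|) - τ * x ^ 2 + τ ≤ (C + τ + C ^ 2 / (2 * τ)) - τ / 2 * x ^ 2 := by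
    have : C * |x| ≤ C ^ 2 / (2 * τ) + τ / 2 * x ^ 2 := by
      rw [← sq_abs x]
      have e : C ^ 2 / (2 * τ) + τ / 2 * |x| ^ 2 - C * |x| = (C - τ * |x|) ^ 2 / (2 * τ) := by
        field_simp; ring
      have : 0 ≤ (C - τ * |x|) ^ 2 / (2 * τ) := by positivity
      linarith
    linarith
  refine (Real.exp_le_exp.2 h1).trans ?_
  rw [sub_eq_add_neg, Real.exp_add, mul_assoc]
  gcongr
  rw [Real.exp_neg]
  have h2 := Real.add_one_le_exp (τ / 2 * x ^ 2)
  calc (Real.exp (τ / 2 * x ^ 2))⁻¹ ≤ (τ / 2 * x ^ 2 + 1)⁻¹ := by gcongr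
    _ ≤ _ := by
      unfold W
      rw [← div_eq_mul_inv, ← one_div, div_le_div_iff₀ (by positivity) (by positivity)]
      have : (1 + 2 / τ) * (τ / 2 * x ^ 2 + 1) = x ^ 2 + τ / 2 * x ^ 2 + 1 + 2 / τ := by
        field_simp; ring
      rw [this]
      have : 0 < 2 / τ := by positivity
      nlinarith [sq_nonneg x]

lemma gauss_re (τ : ℝ) (z w : ℂ) : (-(τ : ℂ) * (z - w) ^ 2).re =
    -τ * ((z.re - w.re) ^ 2 - (z.im - w.im) ^ 2) := by
  rw [← ofReal_neg, re_ofReal_mul]; simp [pow_two]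

lemma le_eLpNorm_top {f : ℝ → ℂ} (hf : Continuous f) (x : ℝ) : ‖f x‖ₑ ≤ eLpNorm f ⊤ volume := by
  rw [eLpNorm_exponent_top]
  have h := enorm_ae_le_eLpNormEssSup f (volume : Measure ℝ)
  have hd := Measure.dense_of_ae h
  have hc : IsClosed {x | ‖f x‖ₑ ≤ eLpNormEssSup f volume} := isClosed_le (by fun_prop) continuous_const
  have := hc.closure_eq
  rw [hd.closure_eq] at this
  have hx : x ∈ (univ : Set ℝ) := trivial
  rw [this] at hx
  exact hx

lemma trace_of_cont {h : ℂ → ℂ} {K : ℝ} (hc : ContinuousOn h {z : ℂ | 0 ≤ z.im ∧ z.im ≤ 1})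
    (hK : ∀ z : ℂ, 0 ≤ z.im → z.im ≤ 1 → ‖h z‖ ≤ K) {b : ℝ} (hb : b ∈ Icc (0:ℝ) 1) {l : Filter ℝ}
    [l.IsCountablyGenerated]
    (hl : Tendsto id l (𝓝 b)) (hm : ∀ᶠ y in l, y ∈ Icc (0:ℝ) 1) (φ : SchwartzMap ℝ ℂ) :
    Tendsto (fun y : ℝ => ∫ x : ℝ, h (x + y * Complex.I) * (starRingEnd ℂ) (φ x))
      l (𝓝 (∫ x : ℝ, bLine h b x * (starRingEnd ℂ) (φ x))) := by
  have hlc : ∀ y ∈ Icc (0:ℝ) 1, Continuous fun x : ℝ => h (x + y * I) := by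
    intro y hy
    refine hc.comp_continuous (by fun_prop) fun x => ?_
    simpa using hy
  refine tendsto_integral_filter_of_dominated_convergence (fun x => K * ‖φ x‖) ?_ ?_ ?_ ?_
  · filter_upwards [hm] with y hy
    exact ((hlc y hy).mul (continuous_conj.comp φ.continuous)).aestronglyMeasurable
  · filter_upwards [hm] with y hy
    refine Eventually.of_forall fun x => ?_
    rw [norm_mul, RCLike.norm_conj]
    have := hK (x + y * I) (by simpa using hy.1) (by simpa using hy.2)
    gcongr
  · exact φ.integrable.norm.const_mul K
  · refine Eventually.of_forall fun x => ?_
    refine Tendsto.mul_const _ ?_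
    have h1 : ContinuousWithinAt h {z : ℂ | 0 ≤ z.im ∧ z.im ≤ 1} (x + b * I) :=
      hc _ (by simpa using hb)
    refine h1.tendsto.comp (tendsto_nhdsWithin_iff.2 ⟨?_, ?_⟩)
    · have : Continuous fun y : ℝ => (x + y * I : ℂ) := by fun_prop
      exact (this.tendsto b).comp hl
    · filter_upwards [hm] with y hy
      simpa using hy

lemma hardy_of_bound {h : ℂ → ℂ} {K : ℝ} (hK0 : 0 < K) (hc : ContinuousOn h {z : ℂ | 0 ≤ z.im ∧ z.im ≤ 1})
    (hK : ∀ z : ℂ, 0 ≤ z.im → z.im ≤ 1 → ‖h z‖ ≤ K * W z.re) : hardyNorm 1 ⊤ h < ⊤ := by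
  have hlc : ∀ y ∈ Icc (0:ℝ) 1, Continuous (bLine h y) := by
    intro y hy
    refine hc.comp_continuous (by fun_prop) fun x => ?_
    simpa using hy
  have hb : ∀ y ∈ Icc (0:ℝ) 1, ∀ x, ‖bLine h y x‖ ≤ K * W x := by
    intro y hy x
    simpa [bLine] using hK (x + y * I) (by simpa using hy.1) (by simpa using hy.2)
  set Z1 : ℝ≥0∞ := eLpNorm (fun x => K * W x) 1 volume with hZ1
  have hZ1' : Z1 < ⊤ := by
    have : MemLp (fun x => K * W x) 1 volume := memLp_one_iff_integrable.2 (W_int.const_mul K)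
    exact this.2
  have key : hardyNorm 1 ⊤ h ≤ ENNReal.ofReal 2 * Z1 + ENNReal.ofReal 2 * ENNReal.ofReal K := by
    refine iSup₂_le fun y hy => ?_
    have hy' : y ∈ Icc (0:ℝ) 1 := ⟨hy.1.le, hy.2.le⟩
    rcases le_total y (1/2) with h2 | h2
    · refine iInf_le_of_le (bLine h y) (iInf_le_of_le 0 (iInf_le_of_le (hlc y hy').measurable
        (iInf_le_of_le measurable_const (iInf_le_of_le (by simp) ?_))))
      rw [eLpNorm_zero, mul_zero, add_zero]
      refine le_add_right ?_
      gcongr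
      · rw [inv_le_comm₀ (by linarith [hy.2]) (by norm_num)]; linarith
      · refine eLpNorm_mono_real fun x => hb y hy' x
    · refine iInf_le_of_le 0 (iInf_le_of_le (bLine h y) (iInf_le_of_le measurable_const
        (iInf_le_of_le (hlc y hy').measurable (iInf_le_of_le (by simp) ?_))))
      rw [eLpNorm_zero, mul_zero, zero_add]
      refine le_add_left ?_
      gcongr
      · rw [inv_le_comm₀ (by linarith) (by norm_num)]; linarith
      · rw [eLpNorm_exponent_top]
        refine eLpNormEssSup_le_of_ae_bound (Eventually.of_forall fun x => ?_)
        refine (hb y hy' x).trans ?_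
        nlinarith [W_le_one x]
  refine lt_of_le_of_lt key ?_
  exact ENNReal.add_lt_top.2 ⟨ENNReal.mul_lt_top ENNReal.ofReal_lt_top hZ1',
    ENNReal.mul_lt_top ENNReal.ofReal_lt_top ENNReal.ofReal_lt_top⟩

lemma gauss_small {τ : ℝ} (hτ : 0 < τ) (x s : ℝ) (hs : s ^ 2 ≤ 1) :
    τ * (1 + |x|) + -τ * (x ^ 2 - s ^ 2) ≤ 3 * τ := by
  have : |x| - x ^ 2 ≤ 1 := by rw [← sq_abs]; nlinarith [sq_nonneg (|x| - 1), abs_nonneg x]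
  nlinarith

lemma lower_bound {α : ℝ} (hα : α ∈ Ioo (0:ℝ) 1) {τ : ℝ} (hτ : 0 < τ) :
    ∃ r ∈ ratioSet 1 ⊤ α, Real.exp ((∫ t, Pker α t * ua α t) - 4 * τ) ≤ r := by
  obtain ⟨M, hu⟩ := ua_lip hα
  obtain ⟨ε, hε, L, C, hL, hL0, hL1, hLα, hLC⟩ := exists_L hu hα hτ
  obtain ⟨K, hK0, hK⟩ := gauss_W C hτ
  set h : ℂ → ℂ := fun z => Complex.exp (L z + -(τ:ℂ) * (z - α * I) ^ 2) with hh
  have hn : ∀ z, ‖h z‖ = Real.exp ((L z).re + -τ * (z.re ^ 2 - (z.im - α) ^ 2)) := by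
    intro z
    rw [hh, Complex.norm_exp, add_re, gauss_re]; simp
  have hα2 : ∀ y : ℝ, 0 ≤ y → y ≤ 1 → (y - α) ^ 2 ≤ 1 := by
    intro y h0 h1; nlinarith [hα.1, hα.2]
  have hsub : {z : ℂ | 0 ≤ z.im ∧ z.im ≤ 1} ⊆ {z : ℂ | -ε < z.im ∧ z.im < 1 + ε} :=
    fun z hz => ⟨by linarith [hz.1], by linarith [hz.2]⟩
  have hd : DifferentiableOn ℂ h {z : ℂ | -ε < z.im ∧ z.im < 1 + ε} := by
    refine DifferentiableOn.cexp (hL.add ?_)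
    fun_prop
  have hc : ContinuousOn h {z : ℂ | 0 ≤ z.im ∧ z.im ≤ 1} := hd.continuousOn.mono hsub
  have hKW : ∀ z : ℂ, 0 ≤ z.im → z.im ≤ 1 → ‖h z‖ ≤ K * W z.re := by
    intro z h0 h1
    rw [hn]
    refine le_trans (Real.exp_le_exp.2 ?_) (hK z.re)
    have := hLC z h0 h1
    have h3 := hα2 z.im h0 h1
    nlinarith [le_abs_self (L z).re]
  have hKK : ∀ z : ℂ, 0 ≤ z.im → z.im ≤ 1 → ‖h z‖ ≤ K := by
    intro z h0 h1
    refine (hKW z h0 h1).trans ?_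
    nlinarith [W_le_one z.re]
  have hlc : ∀ y ∈ Icc (0:ℝ) 1, Continuous (bLine h y) := by
    intro y hy
    refine hc.comp_continuous (by fun_prop) fun x => ?_
    simpa using hy
  have i0 : (0:ℝ) ∈ Icc (0:ℝ) 1 := by simp
  have i1 : (1:ℝ) ∈ Icc (0:ℝ) 1 := by simp
  have iα : α ∈ Icc (0:ℝ) 1 := ⟨hα.1.le, hα.2.le⟩
  have hb0 : ∀ x, ‖bLine h 0 x‖ ≤ Real.exp (3 * τ) * (Pker α x / (1 - α)) := by
    intro x
    rw [← exp_ua hα, ← Real.exp_add]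
    simp only [bLine]
    rw [hn]
    apply Real.exp_le_exp.2
    have h1 := hL0 x
    have h2 := gauss_small hτ x (0 - α) (hα2 0 le_rfl zero_le_one)
    simp only [ofReal_zero, zero_mul, add_zero, ofReal_re, ofReal_im]
    linarith [le_abs_self ((L x).re - ua α x)]
  have hb1 : ∀ x, ‖bLine h 1 x‖ ≤ Real.exp (3 * τ) := by
    intro x
    simp only [bLine]
    rw [hn]
    apply Real.exp_le_exp.2
    have h1 := hL1 x
    have h2 := gauss_small hτ x (1 - α) (hα2 1 zero_le_one le_rfl)
    simp only [ofReal_one, one_mul, add_re, add_im, I_re, I_im, add_zero, ofReal_re, ofReal_im, zero_add]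
    linarith [le_abs_self ((L (x + I)).re)]
  have hα' : 0 < 1 - α := by linarith [hα.2]
  have hPi : Integrable fun x => Real.exp (3 * τ) * (Pker α x / (1 - α)) :=
    ((Pker_int (y := α) ⟨hα.1, by linarith [hα.2]⟩).div_const _).const_mul _
  have hIntg0 : Integrable (bLine h 0) :=
    hPi.mono' (hlc 0 i0).aestronglyMeasurable (Eventually.of_forall hb0)
  have hne : ∀ y x, bLine h y x ≠ 0 := fun y x => Complex.exp_ne_zero _
  have hmem0 : MemLp (bLine h 0) 1 volume := memLp_one_iff_integrable.2 hIntg0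
  have hmem1 : MemLp (bLine h 1) ⊤ volume :=
    memLp_top_of_bound (hlc 1 i1).aestronglyMeasurable _ (Eventually.of_forall hb1)
  have hmemα : MemLp (bLine h α) ⊤ volume := by
    refine memLp_top_of_bound (C := K) (hlc α iα).aestronglyMeasurable (Eventually.of_forall fun x => ?_)
    exact hKK _ (by simpa using iα.1) (by simpa using iα.2)
  have hpos : ∀ p : ℝ≥0∞, p ≠ 0 → ∀ y ∈ Icc (0:ℝ) 1, MemLp (bLine h y) p volume →
      0 < (eLpNorm (bLine h y) p volume).toReal := by
    intro p hp y hy hm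
    refine ENNReal.toReal_pos ?_ hm.2.ne
    intro h0
    rw [eLpNorm_eq_zero_iff (hlc y hy).aestronglyMeasurable hp] at h0
    obtain ⟨x, hx⟩ := h0.exists
    exact hne y x hx
  have hA := hpos 1 one_ne_zero 0 i0 hmem0
  have hB := hpos ⊤ ENNReal.top_ne_zero 1 i1 hmem1
  have hA' : (eLpNorm (bLine h 0) 1 volume).toReal ≤ Real.exp (3 * τ) := by
    rw [eLpNorm_one_eq_lintegral_enorm, ← integral_norm_eq_lintegral_enorm hIntg0.aestronglyMeasurable]
    refine (integral_mono hIntg0.norm hPi hb0).trans ?_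
    rw [integral_const_mul, integral_div, Pker_integral ⟨hα.1, by linarith [hα.2]⟩, div_self hα'.ne', mul_one]
  have hB' : (eLpNorm (bLine h 1) ⊤ volume).toReal ≤ Real.exp (3 * τ) := by
    refine ENNReal.toReal_le_of_le_ofReal (Real.exp_pos _).le ?_
    rw [eLpNorm_exponent_top]
    exact eLpNormEssSup_le_of_ae_bound (Eventually.of_forall hb1)
  have hS : Real.exp ((∫ t, Pker α t * ua α t) - τ) ≤ (eLpNorm (bLine h α) ⊤ volume).toReal := by
    have h1 := le_eLpNorm_top (hlc α iα) 0
    have h2 := ENNReal.toReal_mono hmemα.2.ne h1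
    rw [toReal_enorm] at h2
    refine le_trans ?_ h2
    simp only [bLine]
    rw [hn]
    apply Real.exp_le_exp.2
    have := neg_abs_le ((L (α * I)).re - ∫ t, Pker α t * ua α t)
    simp
    linarith
  refine ⟨_, ⟨h, bLine h 0, bLine h 1, ⟨hd.mono ?_, hardy_of_bound hK0 hc hKW⟩, ⟨α * I, ?_, ?_⟩, ?_, ?_,
    hmem0, hmem1, rfl⟩, ?_⟩
  · intro z hz
    exact ⟨by linarith [hz.1], by linarith [hz.2]⟩
  · simpa [Strip] using hα
  · exact Complex.exp_ne_zero _
  · intro φ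
    refine trace_of_cont hc hKK i0 (tendsto_id.mono_left nhdsWithin_le_nhds) ?_ φ
    filter_upwards [Ioo_mem_nhdsGT (zero_lt_one' ℝ)] with y hy using ⟨hy.1.le, hy.2.le⟩
  · intro φ
    refine trace_of_cont hc hKK i1 (tendsto_id.mono_left nhdsWithin_le_nhds) ?_ φ
    filter_upwards [Ioo_mem_nhdsLT (zero_lt_one' ℝ)] with y hy using ⟨hy.1.le, hy.2.le⟩
  · set A := (eLpNorm (bLine h 0) 1 volume).toReal
    set B := (eLpNorm (bLine h 1) ⊤ volume).toReal
    have hden : A ^ (1 - α) * B ^ α ≤ Real.exp (3 * τ) := by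
      calc A ^ (1 - α) * B ^ α ≤ Real.exp (3 * τ) ^ (1 - α) * Real.exp (3 * τ) ^ α := by
            have := hα.1.le
            gcongr
        _ = _ := by rw [← Real.rpow_add (Real.exp_pos _)]; simp
    rw [le_div_iff₀ (by positivity)]
    calc _ ≤ Real.exp ((∫ t, Pker α t * ua α t) - 4 * τ) * Real.exp (3 * τ) := by gcongr
      _ = Real.exp ((∫ t, Pker α t * ua α t) - τ) := by rw [← Real.exp_add]; ring_nf
      _ ≤ _ := hS

/-- line bound -/
def LineBd (h : ℂ → ℂ) (x₀ N : ℝ) : Prop :=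
  ∀ y ∈ Ioo (0:ℝ) 1, Integrable (fun x : ℝ => ‖h (x + y * I)‖ * W (x - x₀)) ∧
    ∫ x : ℝ, ‖h (x + y * I)‖ * W (x - x₀) ≤ N

lemma h_line_cont {h : ℂ → ℂ} (hc : ContinuousOn h Strip) {y : ℝ} (hy : y ∈ Ioo (0:ℝ) 1) :
    Continuous fun x : ℝ => h (x + y * I) := by
  refine hc.comp_continuous (by fun_prop) fun x => ?_
  simpa [Strip] using hy

lemma W_sub_cont (x₀ : ℝ) : Continuous fun x => W (x - x₀) := W_cont.comp (by fun_prop)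
lemma W_sub_int (x₀ : ℝ) : Integrable fun x => W (x - x₀) := W_int.comp_sub_right x₀

lemma line_bound {h : ℂ → ℂ} (hc : ContinuousOn h Strip) (hh : hardyNorm 1 ⊤ h < ⊤) (x₀ : ℝ) :
    ∃ N, 0 ≤ N ∧ LineBd h x₀ N := by
  set N' : ℝ≥0∞ := hardyNorm 1 ⊤ h + 1 with hN'
  have hN't : N' < ⊤ := ENNReal.add_lt_top.2 ⟨hh, ENNReal.one_lt_top⟩
  set b : ℝ≥0∞ := ∫⁻ x, ENNReal.ofReal (W (x - x₀)) with hb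
  have hbt : b < ⊤ := by
    have := (W_sub_int x₀).2
    rw [hasFiniteIntegral_iff_ofReal (Eventually.of_forall fun x => (W_pos _).le)] at this
    exact this
  have key : ∀ y ∈ Ioo (0:ℝ) 1, ∫⁻ x : ℝ, ENNReal.ofReal (‖h (x + y * I)‖ * W (x - x₀)) ≤ N' + N' * b := by
    intro y hy
    have h1 : (⨅ (f : ℝ → ℂ) (g : ℝ → ℂ) (_ : Measurable f) (_ : Measurable g)
      (_ : f + g = bLine h y),
      ENNReal.ofReal (1 - y)⁻¹ * eLpNorm f 1 volume +
        ENNReal.ofReal y⁻¹ * eLpNorm g ⊤ volume) < N' := by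
      refine lt_of_le_of_lt (le_iSup₂ (f := fun y (_ : y ∈ Ioo (0:ℝ) 1) =>
        ⨅ (f : ℝ → ℂ) (g : ℝ → ℂ) (_ : Measurable f) (_ : Measurable g)
      (_ : f + g = bLine h y),
      ENNReal.ofReal (1 - y)⁻¹ * eLpNorm f 1 volume +
        ENNReal.ofReal y⁻¹ * eLpNorm g ⊤ volume) y hy) ?_
      exact ENNReal.lt_add_right hh.ne one_ne_zero
    simp only [iInf_lt_iff] at h1
    obtain ⟨f, g, hf, hg, hfg, hlt⟩ := h1
    have e1 : (1:ℝ≥0∞) ≤ ENNReal.ofReal (1 - y)⁻¹ := by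
      rw [ENNReal.one_le_ofReal]
      exact (one_le_inv₀ (by linarith [hy.2])).2 (by linarith [hy.1])
    have e2 : (1:ℝ≥0∞) ≤ ENNReal.ofReal y⁻¹ := by
      rw [ENNReal.one_le_ofReal]
      exact (one_le_inv₀ hy.1).2 hy.2.le
    have f1 : eLpNorm f 1 volume ≤ N' := by
      calc _ = 1 * eLpNorm f 1 volume := (one_mul _).symm
        _ ≤ _ := by gcongr
        _ ≤ _ := le_self_add
        _ ≤ _ := hlt.le
    have g1 : eLpNorm g ⊤ volume ≤ N' := by
      calc _ = 1 * eLpNorm g ⊤ volume := (one_mul _).symm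
        _ ≤ _ := by gcongr
        _ ≤ _ := le_add_self
        _ ≤ _ := hlt.le
    have hx : ∀ x : ℝ, h (x + y * I) = f x + g x := fun x => (congrFun hfg x).symm
    calc ∫⁻ x : ℝ, ENNReal.ofReal (‖h (x + y * I)‖ * W (x - x₀))
        ≤ ∫⁻ x : ℝ, (‖f x‖ₑ + ‖g x‖ₑ * ENNReal.ofReal (W (x - x₀))) := by
          refine lintegral_mono fun x => ?_
          rw [hx, ENNReal.ofReal_mul (norm_nonneg _), ofReal_norm]
          calc _ ≤ (‖f x‖ₑ + ‖g x‖ₑ) * ENNReal.ofReal (W (x - x₀)) := by gcongr; exact enorm_add_le _ _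
            _ = ‖f x‖ₑ * ENNReal.ofReal (W (x - x₀)) + ‖g x‖ₑ * ENNReal.ofReal (W (x - x₀)) := add_mul _ _ _
            _ ≤ ‖f x‖ₑ * 1 + ‖g x‖ₑ * ENNReal.ofReal (W (x - x₀)) := by
              gcongr; exact ENNReal.ofReal_le_one.2 (W_le_one _)
            _ = _ := by rw [mul_one]
      _ = (∫⁻ x : ℝ, ‖f x‖ₑ) + ∫⁻ x : ℝ, ‖g x‖ₑ * ENNReal.ofReal (W (x - x₀)) :=
          lintegral_add_left hf.enorm _
      _ ≤ N' + ∫⁻ x : ℝ, N' * ENNReal.ofReal (W (x - x₀)) := by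
          gcongr ?_ + ?_
          · rw [← eLpNorm_one_eq_lintegral_enorm]; exact f1
          · refine lintegral_mono_ae ?_
            filter_upwards [enorm_ae_le_eLpNormEssSup g volume] with x hx
            gcongr
            rw [eLpNorm_exponent_top] at g1
            exact hx.trans g1
      _ = _ := by rw [lintegral_const_mul _ (by have := (W_sub_cont x₀).measurable; fun_prop)]
  have hT : N' + N' * b < ⊤ := ENNReal.add_lt_top.2 ⟨hN't, ENNReal.mul_lt_top hN't hbt⟩
  refine ⟨(N' + N' * b).toReal, ENNReal.toReal_nonneg, fun y hy => ?_⟩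
  have hnn : ∀ x : ℝ, 0 ≤ ‖h (x + y * I)‖ * W (x - x₀) := fun x =>
    mul_nonneg (norm_nonneg _) (W_pos _).le
  have hm : AEStronglyMeasurable (fun x : ℝ => ‖h (x + y * I)‖ * W (x - x₀)) volume :=
    ((h_line_cont hc hy).norm.mul (W_sub_cont x₀)).aestronglyMeasurable
  have hIntg : Integrable (fun x : ℝ => ‖h (x + y * I)‖ * W (x - x₀)) := by
    refine ⟨hm, ?_⟩
    rw [hasFiniteIntegral_iff_ofReal (Eventually.of_forall hnn)]
    exact lt_of_le_of_lt (key y hy) hT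
  refine ⟨hIntg, ?_⟩
  rw [integral_eq_lintegral_of_nonneg_ae (Eventually.of_forall hnn) hm]
  exact ENNReal.toReal_mono hT.ne (key y hy)

lemma line_int {h : ℂ → ℂ} (hc : ContinuousOn h Strip) {x₀ N : ℝ} (hN : LineBd h x₀ N)
    {y : ℝ} (hy : y ∈ Ioo (0:ℝ) 1) {ψ : ℝ → ℂ} (hψ : Continuous ψ) {C : ℝ}
    (hb : ∀ x, ‖ψ x‖ ≤ C * W (x - x₀)) : Integrable (fun x : ℝ => h (x + y * I) * ψ x) ∧
      ‖∫ x : ℝ, h (x + y * I) * ψ x‖ ≤ C * N := by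
  have hC : 0 ≤ C := by
    have := (norm_nonneg _).trans (hb x₀)
    have h2 := W_pos (x₀ - x₀)
    exact nonneg_of_mul_nonneg_left this h2
  obtain ⟨h1, h2⟩ := hN y hy
  have hle : ∀ x : ℝ, ‖h (x + y * I) * ψ x‖ ≤ C * (‖h (x + y * I)‖ * W (x - x₀)) := by
    intro x
    rw [norm_mul]
    calc _ ≤ ‖h (x + y * I)‖ * (C * W (x - x₀)) := by gcongr; exact hb x
      _ = _ := by ring
  refine ⟨(h1.const_mul C).mono' ((h_line_cont hc hy).mul hψ).aestronglyMeasurable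
    (Eventually.of_forall hle), ?_⟩
  refine (norm_integral_le_of_norm_le (h1.const_mul C) (Eventually.of_forall hle)).trans ?_
  rw [integral_const_mul]
  gcongr

lemma endpoint {h : ℂ → ℂ} (hc : ContinuousOn h Strip) {x₀ N : ℝ} (hN0 : 0 ≤ N) (hN : LineBd h x₀ N)
    {l : Filter ℝ} {b : ℝ} {v : ℝ → ℂ} {D : ℝ} (hl : Tendsto id l (𝓝 b)) (hm : ∀ᶠ y in l, y ∈ Ioo (0:ℝ) 1)
    (tr : ∀ φ : SchwartzMap ℝ ℂ,
      Tendsto (fun y : ℝ => ∫ x : ℝ, h (x + y * Complex.I) * (starRingEnd ℂ) (φ x))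
      l (𝓝 (∫ x : ℝ, v x * (starRingEnd ℂ) (φ x))))
    {Ψ : ℂ → ℂ} {Y : Set ℝ} (hYc : IsCompact Y) (hbY : b ∈ Y) (hY : ∀ᶠ y in l, y ∈ Y)
    (hΨc : ContinuousOn Ψ {z : ℂ | z.im ∈ Y}) {C : ℝ}
    (hΨ : ∀ z : ℂ, z.im ∈ Y → ‖Ψ z‖ ≤ C * W (z.re - x₀) ^ 2)
    (hsm : ContDiff ℝ ∞ (fun x : ℝ => Ψ (x + b * I)))
    (hD : ∀ φ : ℝ → ℂ, Continuous φ → (∀ x : ℝ, ‖φ x‖ ≤ ‖Ψ (x + b * I)‖) → ‖∫ x, v x * φ x‖ ≤ D)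
    {η : ℝ} (hη : 0 < η) :
    ∀ᶠ y : ℝ in l, ‖∫ x : ℝ, h (x + y * I) * Ψ (x + y * I)‖ ≤ D + η := by
  have hC : 0 ≤ C := by
    have := (norm_nonneg _).trans (hΨ (x₀ + b * I) (by simpa using hbY))
    exact nonneg_of_mul_nonneg_left this (by have := W_pos ((x₀ + b * I : ℂ).re - x₀); positivity)
  set η₁ := η / (2 * (N + 1)) with hη₁
  have hη₁0 : 0 < η₁ := by positivity
  set n : ℝ := max 1 (2 * C / η₁) with hn
  have hn1 : 1 ≤ n := le_max_left _ _
  have hn0 : 0 < n := by linarith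
  have hn2 : 2 * C ≤ η₁ * (1 + n ^ 2) := by
    have : 2 * C / η₁ ≤ n := le_max_right _ _
    rw [div_le_iff₀ hη₁0] at this
    nlinarith
  let χ : ContDiffBump x₀ := ⟨n, n + 1, hn0, by linarith⟩
  set φ : ℝ → ℂ := fun x => (χ x : ℂ) * Ψ (x + b * I) with hφ
  have hφsm : ContDiff ℝ ∞ φ := by
    refine ContDiff.mul ?_ hsm
    exact ofRealCLM.contDiff.comp χ.contDiff
  have hφle : ∀ x : ℝ, ‖φ x‖ ≤ ‖Ψ (x + b * I)‖ := by
    intro x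
    rw [hφ, norm_mul, norm_real, Real.norm_of_nonneg χ.nonneg]
    have := χ.le_one (x := x)
    nlinarith [norm_nonneg (Ψ (x + b * I))]
  have hφcs : HasCompactSupport φ := by
    have h1 : HasCompactSupport (fun x => (χ x : ℂ)) := χ.hasCompactSupport.comp_left (g := fun r : ℝ => (r:ℂ)) (by simp)
    exact h1.mul_right
  have hψsm : ContDiff ℝ ∞ (fun x => (starRingEnd ℂ) (φ x)) := conjCLE.contDiff.comp hφsm
  have hψcs : HasCompactSupport (fun x => (starRingEnd ℂ) (φ x)) :=
    hφcs.comp_left (g := fun z : ℂ => (starRingEnd ℂ) z) (by simp)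
  have htr := tr (hψcs.toSchwartzMap hψsm)
  have hcoe : ∀ x, (hψcs.toSchwartzMap hψsm) x = (starRingEnd ℂ) (φ x) := fun _ => rfl
  simp only [hcoe, conj_conj] at htr
  have hDφ := hD φ hφsm.continuous hφle
  -- uniform continuity
  have hcomp : IsCompact (Metric.closedBall x₀ n ×ˢ Y) := (isCompact_closedBall _ _).prod hYc
  have huc := hcomp.uniformContinuousOn_of_continuous
    (f := fun q : ℝ × ℝ => Ψ (q.1 + q.2 * I)) (by
      refine hΨc.comp (by fun_prop) fun q hq => ?_
      simpa using hq.2)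
  have hpos : 0 < η₁ * (1 + n ^ 2)⁻¹ := by positivity
  obtain ⟨δ, hδ, hucδ⟩ := Metric.uniformContinuousOn_iff.1 huc _ hpos
  have hclose : ∀ᶠ y in l, |y - b| < δ := by
    have := Metric.tendsto_nhds.1 hl δ hδ
    simpa [Real.dist_eq] using this
  have hclose2 : ∀ᶠ y : ℝ in l, ‖(∫ x : ℝ, h (x + y * I) * φ x) - ∫ x, v x * φ x‖ < η / 2 := by
    have := Metric.tendsto_nhds.1 htr (η / 2) (by positivity)
    simpa [dist_eq_norm] using this
  filter_upwards [hm, hY, hclose, hclose2] with y hy hyY hyδ hy2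
  have hW2 : ∀ x : ℝ, C * W (x - x₀) ^ 2 ≤ C * W (x - x₀) := by
    intro x
    have h1 := W_pos (x - x₀)
    have h2 := W_le_one (x - x₀)
    have : W (x - x₀) ^ 2 ≤ W (x - x₀) := by nlinarith
    gcongr
  have hΨlc : ∀ y ∈ Y, Continuous (fun x : ℝ => Ψ (x + y * I)) := by
    intro y hy
    refine hΨc.comp_continuous (by fun_prop) fun x => ?_
    simpa using hy
  have hbd : ∀ y ∈ Y, ∀ x : ℝ, ‖Ψ (x + y * I)‖ ≤ C * W (x - x₀) ^ 2 := by
    intro y hy x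
    simpa using hΨ (x + y * I) (by simpa using hy)
  have hdiff : ∀ x : ℝ, ‖Ψ (x + y * I) - φ x‖ ≤ η₁ * W (x - x₀) := by
    intro x
    rcases le_or_gt |x - x₀| n with hx | hx
    · have hxb : x ∈ Metric.closedBall x₀ n := by simpa [Real.dist_eq] using hx
      have e1 : χ x = 1 := χ.one_of_mem_closedBall hxb
      have e2 : φ x = Ψ (x + b * I) := by rw [hφ]; simp [e1]
      rw [e2]
      have := hucδ (x, y) ⟨hxb, hyY⟩ (x, b) ⟨hxb, hbY⟩ (by
        simp [Prod.dist_eq, Real.dist_eq, hyδ, hδ])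
      rw [dist_eq_norm] at this
      refine this.le.trans ?_
      unfold W
      have : (x - x₀) ^ 2 ≤ n ^ 2 := by rw [← sq_abs]; gcongr
      gcongr
    · have h1 := hbd y hyY x
      have h2 := (hφle x).trans (hbd b hbY x)
      refine (norm_sub_le _ _).trans ?_
      have h3 : 2 * C * W (x - x₀) ≤ η₁ := by
        unfold W
        rw [← div_eq_mul_inv, div_le_iff₀ (by positivity)]
        refine hn2.trans ?_
        have : n ^ 2 ≤ (x - x₀) ^ 2 := by rw [← sq_abs (x - x₀)]; gcongr
        gcongr
      have h4 := W_pos (x - x₀)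
      nlinarith
  have i1 := (line_int hc hN hy (hΨlc y hyY) (fun x => (hbd y hyY x).trans (hW2 x))).1
  have i2 := (line_int hc hN hy hφsm.continuous (fun x => ((hφle x).trans (hbd b hbY x)).trans (hW2 x))).1
  have i3 : ‖∫ x : ℝ, h (x + y * I) * (Ψ (x + y * I) - φ x)‖ ≤ η₁ * N := (line_int hc hN hy ((hΨlc y hyY).sub hφsm.continuous) hdiff).2
  have e : (∫ x : ℝ, h (x + y * I) * Ψ (x + y * I)) =
      (∫ x : ℝ, h (x + y * I) * (Ψ (x + y * I) - φ x)) +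
      (((∫ x : ℝ, h (x + y * I) * φ x) - ∫ x, v x * φ x) + ∫ x, v x * φ x) := by
    simp only [mul_sub]
    rw [integral_sub i1 i2]; ring
  rw [e]
  refine (norm_add_le _ _).trans ?_
  have h5 := norm_add_le ((∫ x : ℝ, h (x + y * I) * φ x) - ∫ x, v x * φ x) (∫ x, v x * φ x)
  have h6 : η₁ * N ≤ η / 2 := by
    rw [hη₁, div_mul_eq_mul_div, div_le_div_iff₀ (by positivity) (by norm_num)]
    nlinarith
  linarith

lemma rect_shift {h k : ℂ → ℂ} (hc : ContinuousOn h Strip) {x₀ N C : ℝ} (hN : LineBd h x₀ N)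
    (hC : 0 ≤ C)
    (hk : DifferentiableOn ℂ k Strip) {y₁ y₂ : ℝ} (h0 : 0 < y₁) (h12 : y₁ ≤ y₂) (h1 : y₂ < 1)
    (i1 : Integrable fun x : ℝ => k (x + y₁ * I)) (i2 : Integrable fun x : ℝ => k (x + y₂ * I))
    (hb : ∀ x y : ℝ, 1 ≤ |x - x₀| → y ∈ Icc y₁ y₂ →
      ‖k (x + y * I)‖ ≤ C * ((1 + ‖h (x + y * I)‖) * W (x - x₀))) :
    ∫ x : ℝ, k (x + y₁ * I) = ∫ x : ℝ, k (x + y₂ * I) := by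
  by_contra hne
  set F : ℝ → ℝ → ℝ≥0∞ := fun x y => ENNReal.ofReal ((1 + ‖h (x + y * I)‖) * W (x - x₀)) with hF
  set μ : Measure ℝ := volume.restrict (Icc y₁ y₂) with hμ
  set s : ℝ → ℝ≥0∞ := fun x => ∫⁻ y, F x y ∂μ with hs
  have hIcc : ∀ y ∈ Icc y₁ y₂, y ∈ Ioo (0:ℝ) 1 := fun y hy => ⟨by linarith [hy.1], by linarith [hy.2]⟩
  have hFm : AEMeasurable (Function.uncurry F) (volume.prod μ) := by
    have h2 : ContinuousOn (fun q : ℝ × ℝ => (1 + ‖h (q.1 + q.2 * I)‖) * W (q.1 - x₀)) (univ ×ˢ Icc y₁ y₂) := by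
      refine ContinuousOn.mul (continuousOn_const.add (ContinuousOn.norm (hc.comp (by fun_prop) fun q hq => ?_)))
        (((W_sub_cont x₀).comp continuous_fst).continuousOn)
      simpa [Strip] using hIcc q.2 hq.2
    have h3 := h2.aemeasurable (μ := volume.prod volume) (MeasurableSet.univ.prod measurableSet_Icc)
    rw [← Measure.prod_restrict, Measure.restrict_univ] at h3
    exact h3.ennreal_ofReal
  have hsfin : ∫⁻ x, s x < ⊤ := by
    have : ∫⁻ x, s x = ∫⁻ y, ∫⁻ x, F x y ∂volume ∂μ := lintegral_lintegral_swap hFm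
    rw [this]
    have hle : ∀ y ∈ Icc y₁ y₂, ∫⁻ x, F x y ≤ ENNReal.ofReal ((∫ x, W (x - x₀)) + N) := by
      intro y hy
      obtain ⟨j1, j2⟩ := hN y (hIcc y hy)
      have e : (fun x : ℝ => (1 + ‖h (x + y * I)‖) * W (x - x₀)) =
          fun x : ℝ => W (x - x₀) + ‖h (x + y * I)‖ * W (x - x₀) := by ext x; ring
      have j3 : Integrable (fun x : ℝ => (1 + ‖h (x + y * I)‖) * W (x - x₀)) := by
        rw [e]; exact (W_sub_int x₀).add j1
      rw [hF]
      rw [← ofReal_integral_eq_lintegral_ofReal j3 (Eventually.of_forall fun x => by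
        have := W_pos (x - x₀); simp only [Pi.zero_apply]; positivity)]
      apply ENNReal.ofReal_le_ofReal
      rw [e, integral_add (W_sub_int x₀) j1]
      gcongr
    calc _ ≤ ∫⁻ y in Icc y₁ y₂, ENNReal.ofReal ((∫ x, W (x - x₀)) + N) :=
          setLIntegral_mono measurable_const hle
      _ < ⊤ := by
        rw [setLIntegral_const]
        exact ENNReal.mul_lt_top ENNReal.ofReal_lt_top (by simp)
  set d : ℝ := ‖(∫ x : ℝ, k (x + y₁ * I)) - ∫ x : ℝ, k (x + y₂ * I)‖ with hd
  have hd0 : 0 < d := norm_pos_iff.2 (sub_ne_zero.2 hne)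
  have hlim : Tendsto (fun R : ℝ => ‖(∫ x in (-R)..R, k (x + y₁ * I)) - ∫ x in (-R)..R, k (x + y₂ * I)‖)
      atTop (𝓝 d) :=
    ((intervalIntegral_tendsto_integral i1 tendsto_neg_atTop_atBot tendsto_id).sub
      (intervalIntegral_tendsto_integral i2 tendsto_neg_atTop_atBot tendsto_id)).norm
  have hev := hlim.eventually_const_lt (show d / 2 < d by linarith)
  obtain ⟨R₀, hR₀⟩ := eventually_atTop.1 hev
  set R₁ := max R₀ (|x₀| + 1) with hR₁
  have hside : ∀ x : ℝ, 1 ≤ |x - x₀| → ‖∫ y in y₁..y₂, k (x + y * I)‖ₑ ≤ ENNReal.ofReal C * s x := by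
    intro x hx
    rw [intervalIntegral.integral_of_le h12]
    refine (enorm_integral_le_lintegral_enorm _).trans ?_
    calc _ ≤ ∫⁻ y in Icc y₁ y₂, ‖k (x + y * I)‖ₑ := lintegral_mono_set Ioc_subset_Icc_self
      _ ≤ ∫⁻ y in Icc y₁ y₂, ENNReal.ofReal C * F x y := by
        refine setLIntegral_mono' measurableSet_Icc fun y hy => ?_
        rw [← ofReal_norm, hF, ← ENNReal.ofReal_mul hC]
        exact ENNReal.ofReal_le_ofReal (hb x y hx hy)
      _ = _ := by rw [lintegral_const_mul' _ _ ENNReal.ofReal_ne_top]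
  have hmain : ∀ R ∈ Ici R₁, ENNReal.ofReal (d / 2) ≤ ENNReal.ofReal C * (s R + s (-R)) := by
    intro R hR
    have hRx : |x₀| + 1 ≤ R := (le_max_right _ _).trans hR
    have a1 : 1 ≤ |R - x₀| := by
      have := le_abs_self (R - x₀); have := le_abs_self x₀; linarith
    have a2 : 1 ≤ |-R - x₀| := by
      have := neg_le_abs (-R - x₀); have := neg_le_abs x₀; linarith
    have hlt := hR₀ R ((le_max_left _ _).trans hR)
    have hrect := integral_boundary_rect_eq_zero_of_differentiableOn k (⟨-R, y₁⟩ : ℂ) (⟨R, y₂⟩ : ℂ) (by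
      refine hk.mono fun z hz => ?_
      rw [mem_reProdIm] at hz
      have := hz.2
      rw [uIcc_of_le h12] at this
      exact hIcc _ this)
    simp only at hrect
    have e : (∫ x in (-R)..R, k (x + y₁ * I)) - ∫ x in (-R)..R, k (x + y₂ * I) =
        I • (∫ y in y₁..y₂, k (((-R : ℝ):ℂ) + y * I)) - I • (∫ y in y₁..y₂, k (R + y * I)) := by
      linear_combination hrect
    rw [e] at hlt
    calc ENNReal.ofReal (d / 2) ≤ ‖I • (∫ y in y₁..y₂, k (((-R : ℝ):ℂ) + y * I)) - I • (∫ y in y₁..y₂, k (R + y * I))‖ₑ := by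
          rw [← ofReal_norm]; exact ENNReal.ofReal_le_ofReal hlt.le
      _ ≤ ‖I • (∫ y in y₁..y₂, k (((-R : ℝ):ℂ) + y * I))‖ₑ + ‖I • (∫ y in y₁..y₂, k (R + y * I))‖ₑ := enorm_sub_le
      _ = ‖∫ y in y₁..y₂, k (((-R : ℝ):ℂ) + y * I)‖ₑ + ‖∫ y in y₁..y₂, k (R + y * I)‖ₑ := by
          rw [enorm_smul, enorm_smul]
          have : ‖I‖ₑ = 1 := by rw [← ofReal_norm]; simp
          rw [this, one_mul, one_mul]
      _ ≤ ENNReal.ofReal C * s (-R) + ENNReal.ofReal C * s R := by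
          gcongr
          · exact hside (-R) a2
          · exact hside R a1
      _ = _ := by ring
  have hsm : AEMeasurable s volume := hFm.lintegral_prod_right'
  have hcontra : (⊤:ℝ≥0∞) ≤ ENNReal.ofReal C * ((∫⁻ x, s x) + ∫⁻ x, s (-x)) := by
    calc (⊤:ℝ≥0∞) = ∫⁻ _ in Ici R₁, ENNReal.ofReal (d / 2) := by
          rw [setLIntegral_const, Real.volume_Ici, ENNReal.mul_top]
          simpa using hd0
      _ ≤ ∫⁻ R in Ici R₁, ENNReal.ofReal C * (s R + s (-R)) := setLIntegral_mono' measurableSet_Ici hmain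
      _ ≤ ∫⁻ R, ENNReal.ofReal C * (s R + s (-R)) := setLIntegral_le_lintegral _ _
      _ = _ := by rw [lintegral_const_mul' _ _ ENNReal.ofReal_ne_top, lintegral_add_left' hsm]
  have hneg : ∫⁻ x, s (-x) = ∫⁻ x, s x := lintegral_neg_eq_self s
  rw [hneg] at hcontra
  have : ENNReal.ofReal C * ((∫⁻ x, s x) + ∫⁻ x, s x) < ⊤ :=
    ENNReal.mul_lt_top ENNReal.ofReal_lt_top (ENNReal.add_lt_top.2 ⟨hsfin, hsfin⟩)
  exact absurd hcontra (not_le.2 this)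

/-- complex denominator -/
def Pd (α : ℝ) (z : ℂ) : ℂ := 2 * (Complex.cosh (π * z) - Real.cos (π * α))

/-- complex Poisson kernel -/
def Pc (α : ℝ) (z : ℂ) : ℂ := Real.sin (π * α) / Pd α z

lemma Pd_eq (α : ℝ) (z : ℂ) : Pd α z =
    4 * (Complex.sinh (π * (z + α * I) / 2) * Complex.sinh (π * (z - α * I) / 2)) := by
  have h1 : (π:ℂ) * z = π * (z + α * I) / 2 + π * (z - α * I) / 2 := by ring
  have h2 : (Real.cos (π * α) : ℂ) = Complex.cosh (π * (z + α * I) / 2 - π * (z - α * I) / 2) := by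
    have : (π:ℂ) * (z + α * I) / 2 - π * (z - α * I) / 2 = ((π * α : ℝ) : ℂ) * I := by push_cast; ring
    rw [this, Complex.cosh_mul_I, Complex.ofReal_cos]
  unfold Pd
  rw [h2, h1, Complex.cosh_add, Complex.cosh_sub]
  ring

lemma Pd_diff (α : ℝ) : Differentiable ℂ (Pd α) := by
  unfold Pd; fun_prop

lemma Pd_hasDeriv (α : ℝ) (z : ℂ) : HasDerivAt (Pd α) (2 * (Complex.sinh (π * z) * π)) z := by
  unfold Pd
  have h1 : HasDerivAt (fun z : ℂ => (π:ℂ) * z) (π:ℂ) z := by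
    simpa using (hasDerivAt_id z).const_mul (π:ℂ)
  exact (((Complex.hasDerivAt_cosh _).comp z h1).sub_const _).const_mul 2

lemma re_aux (z : ℂ) (a : ℝ) : ((π:ℂ) * (z + a * I) / 2) = ⟨π * z.re / 2, π * (z.im + a) / 2⟩ := by
  apply Complex.ext <;> simp

lemma re_aux' (z : ℂ) (a : ℝ) : ((π:ℂ) * (z - a * I) / 2) = ⟨π * z.re / 2, π * (z.im - a) / 2⟩ := by
  apply Complex.ext <;> simp

lemma Pd_lower1 (α : ℝ) (z : ℂ) : 4 * Real.sinh (π * z.re / 2) ^ 2 ≤ ‖Pd α z‖ := by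
  rw [Pd_eq, re_aux, re_aux', norm_mul, norm_mul]
  have h1 := abs_sinh_le_norm ⟨π * z.re / 2, π * (z.im + α) / 2⟩
  have h2 := abs_sinh_le_norm ⟨π * z.re / 2, π * (z.im - α) / 2⟩
  simp only at h1 h2
  have h3 := mul_le_mul h1 h2 (abs_nonneg _) (norm_nonneg _)
  rw [← pow_two, sq_abs] at h3
  simp only [Complex.norm_ofNat]
  linarith

lemma Pd_lower2 (α : ℝ) (z : ℂ) : 4 * (|Real.sin (π * (z.im + α) / 2)| * |Real.sin (π * (z.im - α) / 2)|) *
    Real.cosh (π * z.re / 2) ^ 2 ≤ ‖Pd α z‖ := by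
  rw [Pd_eq, re_aux, re_aux', norm_mul, norm_mul]
  have h1 := sin_cosh_le_norm ⟨π * z.re / 2, π * (z.im + α) / 2⟩
  have h2 := sin_cosh_le_norm ⟨π * z.re / 2, π * (z.im - α) / 2⟩
  simp only at h1 h2
  have h3 := mul_le_mul h1 h2 (mul_nonneg (abs_nonneg _) (Real.cosh_pos _).le) (norm_nonneg _)
  simp only [Complex.norm_ofNat]
  nlinarith

lemma sinh_ne_zero_of {w : ℂ} (h1 : |w.im| < π) (h0 : w ≠ 0) : Complex.sinh w ≠ 0 := by
  intro h
  have := norm_sinh_sq w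
  rw [h, norm_zero] at this
  have a : Real.sinh w.re = 0 := by nlinarith [sq_nonneg (Real.sinh w.re), sq_nonneg (Real.sin w.im)]
  have b : Real.sin w.im = 0 := by nlinarith [sq_nonneg (Real.sinh w.re), sq_nonneg (Real.sin w.im)]
  rw [Real.sinh_eq_zero] at a
  rw [abs_lt] at h1
  have c := (Real.sin_eq_zero_iff_of_lt_of_lt h1.1 h1.2).1 b
  exact h0 (Complex.ext a c)

lemma Pd_ne {α : ℝ} (hα : α ∈ Ioo (0:ℝ) 1) {z : ℂ} (h0 : 0 ≤ z.im) (h1 : z.im ≤ 1) (hz : z ≠ α * I) :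
    Pd α z ≠ 0 := by
  have hp := Real.pi_pos
  obtain ⟨a0, a1⟩ := hα
  rw [Pd_eq]
  refine mul_ne_zero (by norm_num) (mul_ne_zero (sinh_ne_zero_of ?_ ?_) (sinh_ne_zero_of ?_ ?_))
  · rw [re_aux, abs_lt]; simp only; constructor <;> nlinarith
  · rw [re_aux]; intro h
    have := congrArg Complex.im h
    simp only [zero_im] at this
    nlinarith
  · rw [re_aux', abs_lt]; simp only; constructor <;> nlinarith
  · intro h
    apply hz
    have hpc : (π:ℂ) ≠ 0 := by exact_mod_cast hp.ne'
    have : (π:ℂ) * (z - α * I) = 0 := by linear_combination 2 * h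
    exact sub_eq_zero.1 ((mul_eq_zero.1 this).resolve_left hpc)

lemma Pc_far (α : ℝ) {z : ℂ} (hz : 1 ≤ |z.re|) : ‖Pc α z‖ ≤ W z.re ^ 2 := by
  have h1 := Pd_lower1 α z
  have h2 := cosh_ge z.re
  have h3 := Real.cosh_sq (π * z.re / 2)
  have h4 : 1 ≤ z.re ^ 2 := by rw [← sq_abs]; nlinarith
  have h5 : (1 + z.re ^ 2) ^ 2 ≤ Real.cosh (π * z.re / 2) ^ 2 := by gcongr
  have h6 : (1 + z.re ^ 2) ^ 2 ≤ ‖Pd α z‖ := by nlinarith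
  unfold Pc W
  rw [norm_div, norm_real, inv_pow]
  have h7 : ‖Real.sin (π * α)‖ ≤ 1 := Real.abs_sin_le_one _
  rw [← one_div]
  gcongr

lemma Pc_near {α : ℝ} (hα : α ∈ Ioo (0:ℝ) 1) {Y : Set ℝ} (hYc : IsCompact Y) (hY : Y ⊆ Icc 0 1)
    (hαY : α ∉ Y) : ∃ C, 0 ≤ C ∧ ∀ z : ℂ, z.im ∈ Y → ‖Pc α z‖ ≤ C * W z.re ^ 2 := by
  have hp := Real.pi_pos
  obtain ⟨a0, a1⟩ := hα
  set s : ℝ → ℝ := fun y => 4 * (|Real.sin (π * (y + α) / 2)| * |Real.sin (π * (y - α) / 2)|) with hs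
  have hsc : Continuous s := by fun_prop
  have hspos : ∀ y ∈ Y, 0 < s y := by
    intro y hy
    have hy1 := hY hy
    have n1 : Real.sin (π * (y + α) / 2) ≠ 0 := by
      apply ne_of_gt
      apply Real.sin_pos_of_pos_of_lt_pi <;> nlinarith [hy1.1, hy1.2]
    have n2 : Real.sin (π * (y - α) / 2) ≠ 0 := by
      intro h
      rw [Real.sin_eq_zero_iff_of_lt_of_lt (by nlinarith [hy1.1, hy1.2]) (by nlinarith [hy1.1, hy1.2])] at h
      have : y = α := by
        have : π * (y - α) = 0 := by linarith
        have := (mul_eq_zero.1 this).resolve_left hp.ne'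
        linarith
      exact hαY (this ▸ hy)
    have := abs_pos.2 n1
    have := abs_pos.2 n2
    rw [hs]; positivity
  obtain ⟨c, hc0, hc⟩ : ∃ c, 0 < c ∧ ∀ y ∈ Y, c ≤ s y := by
    rcases Y.eq_empty_or_nonempty with h | h
    · exact ⟨1, one_pos, by simp [h]⟩
    · obtain ⟨y, hy, hm⟩ := hYc.exists_isMinOn h hsc.continuousOn
      exact ⟨s y, hspos y hy, fun x hx => hm hx⟩
  refine ⟨1 / c, by positivity, fun z hz => ?_⟩
  have h1 := Pd_lower2 α z
  have h2 := cosh_ge z.re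
  have h5 : (1 + z.re ^ 2) ^ 2 ≤ Real.cosh (π * z.re / 2) ^ 2 := by gcongr
  have h6 : c * (1 + z.re ^ 2) ^ 2 ≤ ‖Pd α z‖ := by
    refine le_trans ?_ h1
    have := hc _ hz
    simp only [hs] at this
    gcongr
  unfold Pc W
  rw [norm_div, norm_real, inv_pow]
  have h7 : ‖Real.sin (π * α)‖ ≤ 1 := Real.abs_sin_le_one _
  rw [← one_div, div_mul_div_comm, one_mul]
  gcongr

lemma Pc_zero (α x : ℝ) : Pc α x = (Pker α x : ℂ) := by
  unfold Pc Pd Pker; push_cast; rfl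

lemma Pc_one (α x : ℝ) : Pc α (x + I) = -(Pker (1 - α) x : ℂ) := by
  unfold Pc Pd Pker
  have h1 : (π:ℂ) * (x + I) = π * x + π * I := by ring
  have h2 : π * (1 - α) = π - π * α := by ring
  rw [h1, Complex.cosh_add, Complex.cosh_mul_I, Complex.sinh_mul_I, Complex.cos_pi, Complex.sin_pi, h2,
    Real.sin_pi_sub, Real.cos_pi_sub]
  push_cast
  rw [← div_neg]
  congr 1
  ring

lemma Pd_ne_line {α : ℝ} (hα : α ∈ Ioo (0:ℝ) 1) {z : ℂ} (h0 : 0 ≤ z.im) (h1 : z.im ≤ 1) (hz : z.im ≠ α) :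
    Pd α z ≠ 0 := Pd_ne hα h0 h1 (by rintro rfl; simp at hz)

lemma Pc_line_cont {α : ℝ} (hα : α ∈ Ioo (0:ℝ) 1) (x₀ : ℝ) {Y : Set ℝ} (hY : Y ⊆ Icc 0 1)
    (hαY : α ∉ Y) : ContinuousOn (fun z => Pc α (z - x₀)) {z : ℂ | z.im ∈ Y} := by
  unfold Pc
  refine ContinuousOn.div continuousOn_const ?_ fun z hz => ?_
  · exact ((Pd_diff α).continuous.comp (by fun_prop)).continuousOn
  · have hz : z.im ∈ Y := hz
    have := hY hz
    refine Pd_ne_line hα (by simpa using this.1) (by simpa using this.2) ?_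
    rintro h
    apply hαY
    rw [← h]; simpa using hz

/-- line integral of kernel tends to endpoint value -/
lemma Pc_lim {α : ℝ} (hα : α ∈ Ioo (0:ℝ) 1) (x₀ : ℝ) {l : Filter ℝ} [l.IsCountablyGenerated] {b : ℝ}
    (hl : Tendsto id l (𝓝 b)) {Y : Set ℝ} (hYc : IsCompact Y) (hY : Y ⊆ Icc 0 1)
    (hαY : α ∉ Y) (hbY : b ∈ Y) (hm : ∀ᶠ y in l, y ∈ Y) :
    Tendsto (fun y : ℝ => ∫ x : ℝ, Pc α (x + y * I - x₀)) l (𝓝 (∫ x : ℝ, Pc α (x + b * I - x₀))) := by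
  obtain ⟨C, hC, hb⟩ := Pc_near hα hYc hY hαY
  have hcont := Pc_line_cont hα x₀ hY hαY
  refine tendsto_integral_filter_of_dominated_convergence (fun x => C * W (x - x₀)) ?_ ?_ ?_ ?_
  · filter_upwards [hm] with y hy
    refine Continuous.aestronglyMeasurable ?_
    refine hcont.comp_continuous (f := fun x : ℝ => (x:ℂ) + y * I) (by fun_prop) fun x => ?_
    simpa using hy
  · filter_upwards [hm] with y hy
    refine Eventually.of_forall fun x => ?_
    have := hb (x + y * I - x₀) (by simpa using hy)
    refine this.trans ?_
    have e : ((x:ℂ) + y * I - x₀).re = x - x₀ := by simp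
    rw [e]
    have h1 := W_pos (x - x₀)
    have h2 := W_le_one (x - x₀)
    have : W (x - x₀) ^ 2 ≤ W (x - x₀) := by nlinarith
    gcongr
  · exact (W_sub_int x₀).const_mul C
  · refine Eventually.of_forall fun x => ?_
    have h1 : ContinuousOn (fun y : ℝ => Pc α (x + y * I - x₀)) Y :=
      hcont.comp (f := fun y : ℝ => (x:ℂ) + y * I) (by fun_prop) fun y hy => by simpa using hy
    have h2 : Tendsto id l (𝓝[Y] b) := tendsto_nhdsWithin_iff.2 ⟨hl, hm⟩
    exact (h1 b hbY).tendsto.comp h2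

lemma Pc_int0 {α : ℝ} (hα : α ∈ Ioo (0:ℝ) 1) (x₀ : ℝ) :
    ∫ x : ℝ, Pc α (x + (0:ℝ) * I - x₀) = ((1 - α : ℝ) : ℂ) := by
  have : ∀ x : ℝ, Pc α (x + (0:ℝ) * I - x₀) = ((Pker α (x - x₀) : ℝ) : ℂ) := by
    intro x; rw [← Pc_zero]; congr 1; push_cast; ring
  simp only [this]
  rw [integral_complex_ofReal, integral_sub_right_eq_self (Pker α) x₀, Pker_integral ⟨hα.1, by linarith [hα.2]⟩]

lemma Pc_int1 {α : ℝ} (hα : α ∈ Ioo (0:ℝ) 1) (x₀ : ℝ) :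
    ∫ x : ℝ, Pc α (x + (1:ℝ) * I - x₀) = ((-α : ℝ) : ℂ) := by
  have : ∀ x : ℝ, Pc α (x + (1:ℝ) * I - x₀) = ((-Pker (1 - α) (x - x₀) : ℝ) : ℂ) := by
    intro x; push_cast; rw [← Pc_one]; congr 1; push_cast; ring
  simp only [this]
  rw [integral_complex_ofReal, integral_neg, integral_sub_right_eq_self (Pker (1 - α)) x₀,
    Pker_integral ⟨by linarith [hα.2], by linarith [hα.1]⟩]
  congr 2; ring

lemma Strip_open : IsOpen Strip :=
  (isOpen_lt continuous_const continuous_im).inter (isOpen_lt continuous_im continuous_const)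

lemma Pc_line_int {α : ℝ} (hα : α ∈ Ioo (0:ℝ) 1) (x₀ : ℝ) {y : ℝ} (hy : y ∈ Icc (0:ℝ) 1) (hyα : y ≠ α) :
    Continuous (fun x : ℝ => Pc α (x + y * I - x₀)) ∧
    (∃ C, 0 ≤ C ∧ ∀ x : ℝ, ‖Pc α (x + y * I - x₀)‖ ≤ C * W (x - x₀)) ∧
    Integrable (fun x : ℝ => Pc α (x + y * I - x₀)) := by
  have hs : ({y} : Set ℝ) ⊆ Icc 0 1 := by simpa using hy
  have hn : α ∉ ({y} : Set ℝ) := by simpa using hyα.symm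
  obtain ⟨C, hC, hb⟩ := Pc_near hα isCompact_singleton hs hn
  have hcont := Pc_line_cont hα x₀ hs hn
  have h1 : Continuous (fun x : ℝ => Pc α (x + y * I - x₀)) :=
    hcont.comp_continuous (f := fun x : ℝ => (x:ℂ) + y * I) (by fun_prop) fun x => by simp
  have h2 : ∀ x : ℝ, ‖Pc α (x + y * I - x₀)‖ ≤ C * W (x - x₀) := by
    intro x
    have := hb (x + y * I - x₀) (by simp)
    refine this.trans ?_
    have e : ((x:ℂ) + y * I - x₀).re = x - x₀ := by simp
    rw [e]
    have h1 := W_pos (x - x₀)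
    have h2 := W_le_one (x - x₀)
    have : W (x - x₀) ^ 2 ≤ W (x - x₀) := by nlinarith
    gcongr
  exact ⟨h1, ⟨C, hC, h2⟩, ((W_sub_int x₀).const_mul C).mono' h1.aestronglyMeasurable (Eventually.of_forall h2)⟩

lemma residue {h Φ : ℂ → ℂ} {α : ℝ} (hα : α ∈ Ioo (0:ℝ) 1) (hd : DifferentiableOn ℂ h Strip) {x₀ N : ℝ}
    (hN : LineBd h x₀ N) (hΦ : DifferentiableOn ℂ Φ Strip) {C : ℝ}
    (hΦb : ∀ z ∈ Strip, ‖Φ z‖ ≤ C) {y₁ y₂ : ℝ} (h1 : y₁ ∈ Ioo 0 α) (h2 : y₂ ∈ Ioo α 1) :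
    (h (x₀ + α * I) * Φ (x₀ + α * I)) *
      ((∫ x : ℝ, Pc α (x + y₁ * I - x₀)) - ∫ x : ℝ, Pc α (x + y₂ * I - x₀)) =
    (∫ x : ℝ, h (x + y₁ * I) * (Φ (x + y₁ * I) * Pc α (x + y₁ * I - x₀))) -
      ∫ x : ℝ, h (x + y₂ * I) * (Φ (x + y₂ * I) * Pc α (x + y₂ * I - x₀)) := by
  have hp := Real.pi_pos
  set z0 : ℂ := x₀ + α * I with hz0
  have hz0S : z0 ∈ Strip := by simpa [hz0, Strip] using hα
  have hnb : Strip ∈ 𝓝 z0 := Strip_open.mem_nhds hz0S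
  set c := h z0 * Φ z0 with hcdef
  set G : ℂ → ℂ := fun z => h z * Φ z with hG
  set D : ℂ → ℂ := fun z => Pd α (z - x₀) with hD
  have hGd : DifferentiableOn ℂ (dslope G z0) Strip :=
    (Complex.differentiableOn_dslope hnb).2 (hd.mul hΦ)
  have hDdiff : Differentiable ℂ D := (Pd_diff α).comp (by fun_prop)
  have hDd : DifferentiableOn ℂ (dslope D z0) Strip :=
    (Complex.differentiableOn_dslope hnb).2 hDdiff.differentiableOn
  have hD0 : D z0 = 0 := by
    simp only [hD, hz0]
    rw [Pd_eq]; simp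
  have hsin : Real.sin (π * α) ≠ 0 := by
    apply ne_of_gt
    apply Real.sin_pos_of_pos_of_lt_pi <;> nlinarith [hα.1, hα.2]
  have hDne : ∀ z ∈ Strip, z ≠ z0 → D z ≠ 0 := by
    intro z hz hzz
    refine Pd_ne hα (by simpa using hz.1.le) (by simpa using hz.2.le) ?_
    intro h
    apply hzz
    rw [hz0, ← h]; ring
  have hDsl : ∀ z ∈ Strip, dslope D z0 z ≠ 0 := by
    intro z hz
    rcases eq_or_ne z z0 with rfl | hzz
    · rw [dslope_same]
      have h3 := (Pd_hasDeriv α (z0 - x₀)).comp_sub_const z0 (x₀:ℂ)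
      have h4 : deriv D z0 = _ := h3.deriv
      rw [h4]
      have e : (π:ℂ) * (z0 - x₀) = ((π * α : ℝ):ℂ) * I := by rw [hz0]; push_cast; ring
      rw [e, Complex.sinh_mul_I, ← Complex.ofReal_sin]
      have a1 : ((Real.sin (π * α) : ℝ) : ℂ) ≠ 0 := by exact_mod_cast hsin
      have a2 : (π:ℂ) ≠ 0 := by exact_mod_cast hp.ne'
      exact mul_ne_zero two_ne_zero (mul_ne_zero (mul_ne_zero a1 I_ne_zero) a2)
    · rw [dslope_of_ne _ hzz, slope_def_field, hD0, sub_zero]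
      exact div_ne_zero (hDne z hz hzz) (sub_ne_zero.2 hzz)
  set k : ℂ → ℂ := fun z => (Real.sin (π * α) : ℂ) * dslope G z0 z / dslope D z0 z with hk
  have hkd : DifferentiableOn ℂ k Strip := (hGd.const_mul _).div hDd hDsl
  have hkeq : ∀ z ∈ Strip, z ≠ z0 → k z = (G z - c) * Pc α (z - x₀) := by
    intro z hz hzz
    have a := hDne z hz hzz
    have b := sub_ne_zero.2 hzz
    simp only [hk]
    rw [dslope_of_ne _ hzz, dslope_of_ne _ hzz, slope_def_field, slope_def_field, hD0, sub_zero]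
    unfold Pc
    simp only [hD] at a
    simp only [hD, hG, hcdef]
    field_simp
  have hmem : ∀ x y : ℝ, y ∈ Ioo (0:ℝ) 1 → (x + y * I : ℂ) ∈ Strip := by
    intro x y hy; simpa [Strip] using hy
  have hne : ∀ x y : ℝ, y ≠ α → (x + y * I : ℂ) ≠ z0 := by
    intro x y hy h
    have := congrArg Complex.im h
    simp [hz0] at this
    exact hy this
  have hline : ∀ y : ℝ, y ∈ Ioo (0:ℝ) 1 → y ≠ α →
      Integrable (fun x : ℝ => k (x + y * I)) ∧ ∫ x : ℝ, k (x + y * I) =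
        (∫ x : ℝ, h (x + y * I) * (Φ (x + y * I) * Pc α (x + y * I - x₀))) - c * ∫ x : ℝ, Pc α (x + y * I - x₀) := by
    intro y hy hyα
    obtain ⟨c1, ⟨K, hK, c2⟩, c3⟩ := Pc_line_int hα x₀ (Ioo_subset_Icc_self hy) hyα
    have hΦc : Continuous fun x : ℝ => Φ (x + y * I) := h_line_cont hΦ.continuousOn hy
    have i1 := (line_int (C := C * K) hd.continuousOn hN hy (hΦc.mul c1) (fun x => by
      rw [Pi.mul_apply, norm_mul, mul_assoc]
      exact mul_le_mul (hΦb _ (hmem x y hy)) (c2 x) (norm_nonneg _) ((norm_nonneg _).trans (hΦb _ (hmem x y hy))))).1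
    have i1' : Integrable (fun x : ℝ => h (x + y * I) * (Φ (x + y * I) * Pc α (x + y * I - x₀))) := i1
    have e : (fun x : ℝ => k (x + y * I)) = fun x : ℝ => h (x + y * I) * (Φ (x + y * I) * Pc α (x + y * I - x₀))
        - c * Pc α (x + y * I - x₀) := by
      ext x
      rw [hkeq _ (hmem x y hy) (hne x y hyα)]
      simp only [hG]; ring
    rw [e]
    refine ⟨i1'.sub (c3.const_mul c), ?_⟩
    rw [integral_sub i1' (c3.const_mul c), integral_const_mul]
  have hy1 : y₁ ∈ Ioo (0:ℝ) 1 := ⟨h1.1, h1.2.trans hα.2⟩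
  have hy2 : y₂ ∈ Ioo (0:ℝ) 1 := ⟨hα.1.trans h2.1, h2.2⟩
  obtain ⟨j1, j2⟩ := hline y₁ hy1 h1.2.ne
  obtain ⟨j3, j4⟩ := hline y₂ hy2 h2.1.ne'
  have hC0 : 0 ≤ C := (norm_nonneg _).trans (hΦb _ hz0S)
  have := rect_shift (C := C + ‖c‖) hd.continuousOn hN (by positivity) hkd h1.1 (h1.2.trans h2.1).le h2.2 j1 j3 (by
    intro x y hx hy
    have hyS : y ∈ Ioo (0:ℝ) 1 := ⟨h1.1.trans_le hy.1, hy.2.trans_lt h2.2⟩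
    have hzne : (x + y * I : ℂ) ≠ z0 := by
      intro h
      have := congrArg Complex.re h
      simp [hz0] at this
      rw [this] at hx; simp at hx
      linarith
    rw [hkeq _ (hmem x y hyS) hzne, norm_mul]
    have e : ((x:ℂ) + y * I - x₀).re = x - x₀ := by simp
    have p1 := Pc_far α (z := (x:ℂ) + y * I - x₀) (by rw [e]; exact hx)
    rw [e] at p1
    have p2 := W_pos (x - x₀)
    have p3 := W_le_one (x - x₀)
    have p4 : W (x - x₀) ^ 2 ≤ W (x - x₀) := by nlinarith
    have p5 : ‖G (x + y * I) - c‖ ≤ (C + ‖c‖) * (1 + ‖h (x + y * I)‖) := by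
      refine (norm_sub_le _ _).trans ?_
      simp only [hG]
      rw [norm_mul]
      have := hΦb _ (hmem x y hyS)
      have := mul_le_mul_of_nonneg_left this (norm_nonneg (h (x + y * I)))
      nlinarith [norm_nonneg (h (x + y * I)), norm_nonneg c, mul_nonneg (norm_nonneg c) (norm_nonneg (h (x + y * I)))]
    calc _ ≤ (C + ‖c‖) * (1 + ‖h (x + y * I)‖) * W (x - x₀) :=
          mul_le_mul p5 (p1.trans p4) (norm_nonneg _) (by positivity)
      _ = _ := by ring)
  rw [j2, j4] at this
  linear_combination -this

lemma bline_smooth {Φ : ℂ → ℂ} {ε : ℝ} (hε : 0 < ε) {α : ℝ} (hα : α ∈ Ioo (0:ℝ) 1)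
    (hΦ : DifferentiableOn ℂ Φ {z : ℂ | -ε < z.im ∧ z.im < 1 + ε}) (x₀ : ℝ) {b : ℝ} (hb : b ∈ Icc (0:ℝ) 1)
    (hbα : b ≠ α) : ContDiff ℝ ∞ (fun x : ℝ => Φ (x + b * I) * Pc α (x + b * I - x₀)) := by
  have hop : IsOpen {z : ℂ | -ε < z.im ∧ z.im < 1 + ε} :=
    (isOpen_lt continuous_const continuous_im).inter (isOpen_lt continuous_im continuous_const)
  have hl : ContDiff ℝ ∞ (fun x : ℝ => (x : ℂ) + b * I) := ofRealCLM.contDiff.add contDiff_const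
  have hl2 : ContDiff ℝ ∞ (fun x : ℝ => (x : ℂ) + b * I - x₀) := hl.sub contDiff_const
  refine ContDiff.mul ?_ ?_
  · have h1 : ContDiffOn ℝ ∞ Φ {z : ℂ | -ε < z.im ∧ z.im < 1 + ε} := (hΦ.contDiffOn hop).restrict_scalars ℝ
    refine h1.comp_contDiff hl fun x => ?_
    have := hb.1; have := hb.2
    simp; constructor <;> linarith
  · unfold Pc
    have h2 : ContDiff ℝ ∞ (Pd α) := (Pd_diff α).contDiff.restrict_scalars ℝ
    simp only [div_eq_mul_inv]
    refine contDiff_const.mul ((h2.comp hl2).inv fun x => ?_)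
    exact Pd_ne_line hα (by simpa using hb.1) (by simpa using hb.2) (by simpa using hbα)

lemma upper {h Φ : ℂ → ℂ} {h0 h1 : ℝ → ℂ} {α : ℝ} (hα : α ∈ Ioo (0:ℝ) 1) (hh : MemHardy 1 ⊤ h)
    (t0 : IsTrace0 h h0) (t1 : IsTrace1 h h1) (m0 : MemLp h0 1 volume) (m1 : MemLp h1 ⊤ volume)
    {ε : ℝ} (hε : 0 < ε) (hΦ : DifferentiableOn ℂ Φ {z : ℂ | -ε < z.im ∧ z.im < 1 + ε}) (x₀ : ℝ) {C : ℝ}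
    (hΦb : ∀ z : ℂ, 0 ≤ z.im → z.im ≤ 1 → ‖Φ z‖ ≤ C) {S0 S1 : ℝ}
    (hS0 : ∀ x : ℝ, ‖Φ x‖ * Pker α (x - x₀) ≤ S0) (hS1 : ∀ x : ℝ, ‖Φ (x + I)‖ ≤ S1) :
    ‖h (x₀ + α * I) * Φ (x₀ + α * I)‖ ≤
      (eLpNorm h0 1 volume).toReal * S0 + (eLpNorm h1 ⊤ volume).toReal * S1 * α := by
  obtain ⟨a0, a1⟩ := id hα
  set A := (eLpNorm h0 1 volume).toReal with hA
  set B := (eLpNorm h1 ⊤ volume).toReal with hB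
  obtain ⟨hd, hn⟩ := hh
  have hc := hd.continuousOn
  obtain ⟨N, hN0, hN⟩ := line_bound hc hn x₀
  have hsub : Strip ⊆ {z : ℂ | -ε < z.im ∧ z.im < 1 + ε} := fun z hz => ⟨by linarith [hz.1], by linarith [hz.2]⟩
  have hC0 : 0 ≤ C := (norm_nonneg _).trans (hΦb 0 (by simp) (by simp))
  set Ψ : ℂ → ℂ := fun z => Φ z * Pc α (z - x₀) with hΨ
  have hΨc : ∀ Y : Set ℝ, Y ⊆ Icc 0 1 → α ∉ Y → ContinuousOn Ψ {z : ℂ | z.im ∈ Y} := by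
    intro Y hY hαY
    refine ContinuousOn.mul (hΦ.continuousOn.mono fun z hz => ?_) (Pc_line_cont hα x₀ hY hαY)
    have := hY (show z.im ∈ Y from hz)
    exact ⟨by linarith [this.1], by linarith [this.2]⟩
  have hΨb : ∀ Y : Set ℝ, IsCompact Y → Y ⊆ Icc 0 1 → α ∉ Y → ∃ K, ∀ z : ℂ, z.im ∈ Y → ‖Ψ z‖ ≤ K * W (z.re - x₀) ^ 2 := by
    intro Y hYc hY hαY
    obtain ⟨K, hK, hb⟩ := Pc_near hα hYc hY hαY
    refine ⟨C * K, fun z hz => ?_⟩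
    have := hb (z - x₀) (by simpa using hz)
    simp only [sub_re, ofReal_re] at this
    simp only [hΨ]
    rw [norm_mul, mul_assoc]
    exact mul_le_mul (hΦb z (hY hz).1 (hY hz).2) this (norm_nonneg _) hC0
  set Y0 : Set ℝ := Icc 0 (α / 2) with hY0
  set Y1 : Set ℝ := Icc ((1 + α) / 2) 1 with hY1
  have s0 : Y0 ⊆ Icc 0 1 := Icc_subset_Icc le_rfl (by linarith)
  have s1 : Y1 ⊆ Icc 0 1 := Icc_subset_Icc (by linarith) le_rfl
  have n0 : α ∉ Y0 := fun h => by have := h.2; linarith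
  have n1 : α ∉ Y1 := fun h => by have := h.1; linarith
  have b0 : (0:ℝ) ∈ Y0 := ⟨le_rfl, by linarith⟩
  have b1 : (1:ℝ) ∈ Y1 := ⟨by linarith, le_rfl⟩
  have ev0 : ∀ᶠ y in 𝓝[>] (0:ℝ), y ∈ Ioo 0 (α / 2) := Ioo_mem_nhdsGT (by linarith)
  have ev1 : ∀ᶠ y in 𝓝[<] (1:ℝ), y ∈ Ioo ((1 + α) / 2) 1 := Ioo_mem_nhdsLT (by linarith)
  have l0 : Tendsto id (𝓝[>] (0:ℝ)) (𝓝 0) := tendsto_id.mono_left nhdsWithin_le_nhds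
  have l1 : Tendsto id (𝓝[<] (1:ℝ)) (𝓝 1) := tendsto_id.mono_left nhdsWithin_le_nhds
  obtain ⟨K0, hK0⟩ := hΨb Y0 isCompact_Icc s0 n0
  obtain ⟨K1, hK1⟩ := hΨb Y1 isCompact_Icc s1 n1
  have hAint : ∫ x, ‖h0 x‖ = A := by
    rw [integral_norm_eq_lintegral_enorm m0.1, hA, eLpNorm_one_eq_lintegral_enorm]
  have hD0 : ∀ φ : ℝ → ℂ, Continuous φ → (∀ x : ℝ, ‖φ x‖ ≤ ‖Ψ (x + (0:ℝ) * I)‖) → ‖∫ x, h0 x * φ x‖ ≤ A * S0 := by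
    intro φ _ hφ
    have hφ' : ∀ x, ‖φ x‖ ≤ S0 := by
      intro x
      refine (hφ x).trans ?_
      simp only [hΨ]
      have e1 : (x:ℂ) + (0:ℝ) * I = x := by simp
      have e2 : (x:ℂ) - x₀ = ((x - x₀ : ℝ) : ℂ) := by push_cast; ring
      rw [e1, norm_mul, e2, Pc_zero, norm_real, Real.norm_of_nonneg (Pker_nonneg ⟨a0.le, a1.le⟩ _)]
      exact hS0 x
    rw [← hAint, ← integral_mul_const]
    refine norm_integral_le_of_norm_le ((memLp_one_iff_integrable.1 m0).norm.mul_const S0) (Eventually.of_forall fun x => ?_)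
    rw [norm_mul]
    gcongr
    exact hφ' x
  have hae : ∀ᵐ x, ‖h1 x‖ ≤ B := by
    filter_upwards [enorm_ae_le_eLpNormEssSup h1 volume] with x hx
    rw [← eLpNorm_exponent_top] at hx
    rw [hB, ← toReal_enorm]
    exact ENNReal.toReal_mono m1.2.ne hx
  have hB0 : 0 ≤ B := ENNReal.toReal_nonneg
  have hPi : Integrable (fun x => Pker (1 - α) (x - x₀)) :=
    (Pker_int (y := 1 - α) ⟨by linarith, by linarith⟩).comp_sub_right x₀
  have hPint : ∫ x, Pker (1 - α) (x - x₀) = α := by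
    rw [integral_sub_right_eq_self (Pker (1 - α)) x₀, Pker_integral ⟨by linarith, by linarith⟩]; ring
  have hD1 : ∀ φ : ℝ → ℂ, Continuous φ → (∀ x : ℝ, ‖φ x‖ ≤ ‖Ψ (x + (1:ℝ) * I)‖) → ‖∫ x, h1 x * φ x‖ ≤ B * S1 * α := by
    intro φ _ hφ
    have hφ' : ∀ x, ‖φ x‖ ≤ S1 * Pker (1 - α) (x - x₀) := by
      intro x
      refine (hφ x).trans ?_
      simp only [hΨ]
      have e1 : (x:ℂ) + (1:ℝ) * I = x + I := by simp
      have e2 : (x:ℂ) + I - x₀ = ((x - x₀ : ℝ) : ℂ) + I := by push_cast; ring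
      have hpn := Pker_nonneg (y := 1 - α) ⟨by linarith, by linarith⟩ (x - x₀)
      rw [e1, norm_mul, e2, Pc_one, norm_neg, norm_real, Real.norm_of_nonneg hpn]
      exact mul_le_mul_of_nonneg_right (hS1 x) hpn
    rw [← hPint, ← integral_const_mul]
    refine norm_integral_le_of_norm_le (hPi.const_mul _) ?_
    filter_upwards [hae] with x hx
    rw [norm_mul, mul_assoc]
    exact mul_le_mul hx (hφ' x) (norm_nonneg _) hB0
  have e0 := fun η (hη : (0:ℝ) < η) => endpoint hc hN0 hN (v := h0) (D := A * S0) (Ψ := Ψ) (Y := Y0) (C := K0) l0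
    (ev0.mono fun y hy => ⟨hy.1, by linarith [hy.2]⟩) t0 isCompact_Icc b0 (ev0.mono fun y hy => ⟨hy.1.le, hy.2.le⟩)
    (hΨc Y0 s0 n0) hK0 (bline_smooth hε hα hΦ x₀ (by simp) a0.ne) hD0 hη
  have e1 := fun η (hη : (0:ℝ) < η) => endpoint hc hN0 hN (v := h1) (D := B * S1 * α) (Ψ := Ψ) (Y := Y1) (C := K1) l1
    (ev1.mono fun y hy => ⟨by linarith [hy.1], hy.2⟩) t1 isCompact_Icc b1 (ev1.mono fun y hy => ⟨hy.1.le, hy.2.le⟩)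
    (hΨc Y1 s1 n1) hK1 (bline_smooth hε hα hΦ x₀ (by simp) a1.ne') hD1 hη
  have p0 := Pc_lim hα x₀ l0 isCompact_Icc s0 n0 b0 (ev0.mono fun y hy => ⟨hy.1.le, hy.2.le⟩)
  have p1 := Pc_lim hα x₀ l1 isCompact_Icc s1 n1 b1 (ev1.mono fun y hy => ⟨hy.1.le, hy.2.le⟩)
  rw [Pc_int0 hα] at p0
  rw [Pc_int1 hα] at p1
  set c := h (x₀ + α * I) * Φ (x₀ + α * I) with hcd
  refine le_of_forall_pos_le_add fun η hη => ?_
  have hlim : Tendsto (fun q : ℝ × ℝ => ‖c * ((∫ x : ℝ, Pc α (x + q.1 * I - x₀)) - ∫ x : ℝ, Pc α (x + q.2 * I - x₀))‖)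
      (𝓝[>] (0:ℝ) ×ˢ 𝓝[<] (1:ℝ)) (𝓝 ‖c * (((1 - α : ℝ):ℂ) - ((-α : ℝ):ℂ))‖) :=
    (((p0.comp tendsto_fst).sub (p1.comp tendsto_snd)).const_mul c).norm
  have hone : (((1 - α : ℝ):ℂ) - ((-α : ℝ):ℂ)) = 1 := by push_cast; ring
  rw [hone, mul_one] at hlim
  refine le_of_tendsto hlim ?_
  filter_upwards [(ev0.and (e0 (η / 2) (by positivity))).prod_mk (ev1.and (e1 (η / 2) (by positivity)))] with q hq
  obtain ⟨⟨q1, q2⟩, q3, q4⟩ := hq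
  have hres := residue hα hd hN (hΦ.mono hsub) (C := C) (fun z hz => hΦb z hz.1.le hz.2.le) (y₁ := q.1) (y₂ := q.2)
    ⟨q1.1, by linarith [q1.2]⟩ ⟨by linarith [q3.1], q3.2⟩
  rw [hcd, hres]
  refine (norm_sub_le _ _).trans ?_
  simp only [hΨ] at q2 q4
  linarith

lemma upper_pt {h : ℂ → ℂ} {h0 h1 : ℝ → ℂ} {α : ℝ} (hα : α ∈ Ioo (0:ℝ) 1) (hh : MemHardy 1 ⊤ h)
    (t0 : IsTrace0 h h0) (t1 : IsTrace1 h h1) (m0 : MemLp h0 1 volume) (m1 : MemLp h1 ⊤ volume)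
    (hA : 0 < (eLpNorm h0 1 volume).toReal) (hB : 0 < (eLpNorm h1 ⊤ volume).toReal)
    {τ : ℝ} (hτ : 0 < τ) (x₀ : ℝ) :
    ‖h (x₀ + α * I)‖ ≤ Real.exp ((∫ t, Pker α t * ua α t) + 4 * τ) *
      ((eLpNorm h0 1 volume).toReal ^ (1 - α) * (eLpNorm h1 ⊤ volume).toReal ^ α) := by
  obtain ⟨a0, a1⟩ := id hα
  set A := (eLpNorm h0 1 volume).toReal with hAd
  set B := (eLpNorm h1 ⊤ volume).toReal with hBd
  set J := ∫ t, Pker α t * ua α t with hJ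
  obtain ⟨M, hM⟩ := ua_lip hα
  obtain ⟨ε, hε, L, C, hL, L0, L1, Lα, LC⟩ := exists_L hM hα hτ
  obtain ⟨K, hK, hKb⟩ := gauss_W C hτ
  set lam := Real.log B - Real.log A with hlam
  set z0 : ℂ := x₀ + α * I with hz0
  set E : ℂ → ℂ := fun z => -L (z - x₀) + -(τ:ℂ) * (z - z0) ^ 2 + (lam:ℂ) * I * (z - z0) with hE
  set Φ : ℂ → ℂ := fun z => Complex.exp (E z) with hΦ
  have hnorm : ∀ z, ‖Φ z‖ = Real.exp (-(L (z - x₀)).re + -τ * ((z.re - x₀) ^ 2 - (z.im - α) ^ 2)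
      - lam * (z.im - α)) := by
    intro z
    simp only [hΦ]
    rw [Complex.norm_exp]
    congr 1
    simp only [hE]
    rw [add_re, add_re, gauss_re, neg_re]
    simp [hz0]
    ring
  have hΦd : DifferentiableOn ℂ Φ {z : ℂ | -ε < z.im ∧ z.im < 1 + ε} := by
    have h1 : DifferentiableOn ℂ (fun z => L (z - x₀)) {z : ℂ | -ε < z.im ∧ z.im < 1 + ε} :=
      hL.comp (by fun_prop) fun z hz => by simpa using hz
    have h2 : Differentiable ℂ (fun z : ℂ => -(τ:ℂ) * (z - z0) ^ 2) := by fun_prop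
    have h3 : Differentiable ℂ (fun z : ℂ => (lam:ℂ) * I * (z - z0)) := by fun_prop
    exact ((h1.neg.add h2.differentiableOn).add h3.differentiableOn).cexp
  have hΦb : ∀ z : ℂ, 0 ≤ z.im → z.im ≤ 1 → ‖Φ z‖ ≤ K * Real.exp |lam| := by
    intro z z1 z2
    rw [hnorm]
    have h1 := LC (z - x₀) (by simpa using z1) (by simpa using z2)
    simp only [sub_re, ofReal_re] at h1
    have h2 := (abs_le.1 h1).1
    have h3 : -lam * (z.im - α) ≤ |lam| := by
      have : |lam * (z.im - α)| ≤ |lam| * 1 := by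
        rw [abs_mul]; gcongr; rw [abs_le]; constructor <;> linarith
      have := neg_abs_le (lam * (z.im - α))
      linarith
    have h4 : (z.im - α) ^ 2 ≤ 1 := by nlinarith
    have h5 := mul_le_mul_of_nonneg_left h4 hτ.le
    calc _ ≤ Real.exp ((C * (1 + |z.re - x₀|) - τ * (z.re - x₀) ^ 2 + τ) + |lam|) := by
          apply Real.exp_le_exp.2; linarith
      _ = _ := Real.exp_add _ _
      _ ≤ _ := by
        gcongr
        refine (hKb _).trans ?_
        have := W_le_one (z.re - x₀)
        nlinarith
  have hS0 : ∀ x : ℝ, ‖Φ x‖ * Pker α (x - x₀) ≤ (1 - α) * Real.exp (3 * τ + lam * α) := by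
    intro x
    have hP : Pker α (x - x₀) = (1 - α) * Real.exp (ua α (x - x₀)) := by
      rw [exp_ua hα]; field_simp [show (1 - α) ≠ 0 by linarith]
    rw [hnorm, hP]
    have h1 := (abs_le.1 (L0 (x - x₀))).1
    push_cast at h1
    have h2 := gauss_small hτ (x - x₀) α (by nlinarith)
    rw [mul_left_comm, ← Real.exp_add]
    refine mul_le_mul_of_nonneg_left (Real.exp_le_exp.2 ?_) (by linarith)
    simp only [ofReal_re, ofReal_im]
    nlinarith
  have hS1 : ∀ x : ℝ, ‖Φ (x + I)‖ ≤ Real.exp (3 * τ - lam * (1 - α)) := by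
    intro x
    rw [hnorm]
    have h1 := (abs_le.1 (L1 (x - x₀))).1
    have e : (((x - x₀ : ℝ) : ℂ) + I) = x + I - x₀ := by push_cast; ring
    rw [e] at h1
    have h2 := gauss_small hτ (x - x₀) (1 - α) (by nlinarith)
    refine Real.exp_le_exp.2 ?_
    simp only [add_re, add_im, ofReal_re, ofReal_im, I_re, I_im, add_zero, zero_add]
    linarith
  have hmain := upper hα hh t0 t1 m0 m1 hε hΦd x₀ hΦb hS0 hS1
  have hz : Real.exp (-J - τ) ≤ ‖Φ z0‖ := by
    rw [hnorm]
    have e : z0 - x₀ = α * I := by rw [hz0]; ring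
    have h1 := (abs_le.1 Lα).2
    rw [e]
    refine Real.exp_le_exp.2 ?_
    have e1 : z0.re = x₀ := by simp [hz0]
    have e2 : z0.im = α := by simp [hz0]
    rw [e1, e2]
    simp only [sub_self]
    linarith
  have hr : A ^ (1 - α) * B ^ α = Real.exp (Real.log A * (1 - α) + Real.log B * α) := by
    rw [Real.rpow_def_of_pos hA, Real.rpow_def_of_pos hB, Real.exp_add]
  have r1 : A * ((1 - α) * Real.exp (3 * τ + lam * α)) = (1 - α) * (Real.exp (3 * τ) * (A ^ (1 - α) * B ^ α)) := by
    rw [hr, ← Real.exp_add]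
    nth_rewrite 1 [← Real.exp_log hA]
    rw [mul_left_comm, ← Real.exp_add]
    congr 2
    rw [hlam]; ring
  have r2 : B * Real.exp (3 * τ - lam * (1 - α)) * α = α * (Real.exp (3 * τ) * (A ^ (1 - α) * B ^ α)) := by
    rw [hr, ← Real.exp_add]
    nth_rewrite 1 [← Real.exp_log hB]
    rw [mul_comm _ α, ← Real.exp_add]
    congr 2
    rw [hlam]; ring
  rw [← hz0] at hmain
  rw [norm_mul, ← hAd, ← hBd, r1, r2] at hmain
  have h5 : ‖h z0‖ * Real.exp (-J - τ) ≤ Real.exp (3 * τ) * (A ^ (1 - α) * B ^ α) := by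
    have := mul_le_mul_of_nonneg_left hz (norm_nonneg (h z0))
    linarith
  have h6 : Real.exp (J + 4 * τ) = Real.exp (J + τ) * Real.exp (3 * τ) := by
    rw [← Real.exp_add]; congr 1; ring
  have h7 : Real.exp (J + τ) * Real.exp (-J - τ) = 1 := by
    rw [← Real.exp_add]; simp
  have h8 := mul_le_mul_of_nonneg_left h5 (Real.exp_pos (J + τ)).le
  rw [h6, mul_assoc]
  calc ‖h z0‖ = ‖h z0‖ * (Real.exp (J + τ) * Real.exp (-J - τ)) := by rw [h7, mul_one]
    _ = Real.exp (J + τ) * (‖h z0‖ * Real.exp (-J - τ)) := by ring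
    _ ≤ _ := h8

lemma ratio_le {α : ℝ} (hα : α ∈ Ioo (0:ℝ) 1) {r : ℝ} (hr : r ∈ ratioSet 1 ⊤ α) :
    r ≤ Real.exp (∫ t, Pker α t * ua α t) := by
  obtain ⟨h, h0, h1, hh, -, t0, t1, m0, m1, rfl⟩ := hr
  obtain ⟨a0, a1⟩ := id hα
  have hA0 : 0 ≤ (eLpNorm h0 1 volume).toReal := ENNReal.toReal_nonneg
  have hB0 : 0 ≤ (eLpNorm h1 ⊤ volume).toReal := ENNReal.toReal_nonneg
  rcases hA0.eq_or_lt with hA | hA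
  · rw [← hA, Real.zero_rpow (by linarith), zero_mul, div_zero]; positivity
  rcases hB0.eq_or_lt with hB | hB
  · rw [← hB, Real.zero_rpow (by linarith), mul_zero, div_zero]; positivity
  have key : ∀ τ > 0, (eLpNorm (bLine h α) ⊤ volume).toReal /
        ((eLpNorm h0 1 volume).toReal ^ (1 - α) * (eLpNorm h1 ⊤ volume).toReal ^ α) ≤
      Real.exp ((∫ t, Pker α t * ua α t) + 4 * τ) := by
    intro τ hτ
    rw [div_le_iff₀ (by positivity)]
    have hb := fun x₀ => upper_pt hα hh t0 t1 m0 m1 hA hB hτ x₀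
    set Q := Real.exp ((∫ t, Pker α t * ua α t) + 4 * τ) *
      ((eLpNorm h0 1 volume).toReal ^ (1 - α) * (eLpNorm h1 ⊤ volume).toReal ^ α) with hQ
    have hQ0 : 0 ≤ Q := by positivity
    have h2 : eLpNorm (bLine h α) ⊤ volume ≤ ENNReal.ofReal Q := by
      rw [eLpNorm_exponent_top]
      refine eLpNormEssSup_le_of_ae_bound (Eventually.of_forall fun x => ?_)
      exact hb x
    exact ENNReal.toReal_le_of_le_ofReal hQ0 h2
  have hlim : Tendsto (fun τ : ℝ => Real.exp ((∫ t, Pker α t * ua α t) + 4 * τ)) (𝓝[>] 0)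
      (𝓝 (Real.exp ((∫ t, Pker α t * ua α t) + 4 * 0))) :=
    (Continuous.tendsto (by fun_prop) 0).mono_left nhdsWithin_le_nhds
  rw [mul_zero, add_zero] at hlim
  refine ge_of_tendsto hlim ?_
  filter_upwards [self_mem_nhdsWithin] with τ hτ using key τ hτ

theorem main_eq (α : ℝ) (hα : α ∈ Set.Ioo (0:ℝ) 1) :
    Real.log (Hval 1 ⊤ α) = ∫ x : ℝ, Pker α x * Real.log (Pker α x / (1 - α)) := by
  change Real.log (Hval 1 ⊤ α) = ∫ t, Pker α t * ua α t
  have hbdd : BddAbove (ratioSet 1 ⊤ α) := ⟨_, fun r hr => ratio_le hα hr⟩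
  have : Hval 1 ⊤ α = Real.exp (∫ t, Pker α t * ua α t) := by
    refine le_antisymm ?_ ?_
    · obtain ⟨r, hr, -⟩ := lower_bound hα one_pos
      exact csSup_le ⟨r, hr⟩ fun r hr => ratio_le hα hr
    · have hlim : Tendsto (fun τ : ℝ => Real.exp ((∫ t, Pker α t * ua α t) - 4 * τ)) (𝓝[>] 0)
          (𝓝 (Real.exp ((∫ t, Pker α t * ua α t) - 4 * 0))) :=
        (Continuous.tendsto (by fun_prop) 0).mono_left nhdsWithin_le_nhds
      rw [mul_zero, sub_zero] at hlim
      refine le_of_tendsto hlim ?_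
      filter_upwards [self_mem_nhdsWithin] with τ hτ
      obtain ⟨r, hr, hle⟩ := lower_bound hα hτ
      exact hle.trans (le_csSup hbdd hr)
  rw [this, Real.log_exp]

end helpers

/-- **Optimal value** (Theorem 1.5, first formula): the value of `H_{1,∞}(α)`. -/
theorem log_H_one_inf (α : ℝ) (hα : α ∈ Set.Ioo (0:ℝ) 1) :
    Real.log (Hval 1 ⊤ α) = ∫ x : ℝ, Pker α x * Real.log (Pker α x / (1 - α)) := by
  exact main_eq α hα
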